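/- Let x = x_C be the CGHS map x_C(y) = −log(1 + e^{−y}). Let f be a normalized outgoing wave function which is differentiable with integrable derivative f′, and suppose there exist constants α > 1/2, C > 0 and L ≥ 1 such that |f(y)| ≤ C/|y|^{1+α} for all y ≤ −L. Then for all y₀ > 0, |N̄_o[f_{y₀}] − N̄^Th_{2π}[f_{y₀}]| ≤ 32 C² / (α² (2α − 1) (y₀/4 + L − 1)^{2α−1}) + e^{2L − y₀/2} (‖f‖_{L¹} + ‖f′‖_{L¹})². -/

import Mathlib

open MeasureTheory Set Filter
open scoped ENNReal

/-- The Fourier transform `f̂(p) = (2π)^{-1/2} ∫ f(y) e^{-ipy} dy`. -/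
noncomputable def ft (f : ℝ → ℂ) (p : ℝ) : ℂ :=
  (Real.sqrt (2 * Real.pi) : ℂ)⁻¹ *
    ∫ y : ℝ, f y * Complex.exp (-Complex.I * (p : ℂ) * (y : ℂ))

/-- `F̌(k) = (2π)^{-1/2} ∫ f(y) e^{-ik x(y)} dy`. -/
noncomputable def Fk (x : ℝ → ℝ) (f : ℝ → ℂ) (k : ℝ) : ℂ :=
  (Real.sqrt (2 * Real.pi) : ℂ)⁻¹ *
    ∫ y : ℝ, f y * Complex.exp (-Complex.I * (k : ℂ) * (x y : ℂ))

/-- The relativistic black-hole coordinate map `x_R(y) = -e^{-y}`. -/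
noncomputable def xR (y : ℝ) : ℝ := -Real.exp (-y)

/-- The CGHS black-hole coordinate map `x_C(y) = -log(1+e^{-y})`. -/
noncomputable def xC (y : ℝ) : ℝ := -Real.log (1 + Real.exp (-y))

/-- The mean number of spontaneously created particles `N̄_o[f]`. -/
noncomputable def No (x : ℝ → ℝ) (f : ℝ → ℂ) : ℝ≥0∞ :=
  ∫⁻ k in Set.Ioi (0:ℝ), ENNReal.ofReal (‖Fk x f (-k)‖ ^ 2 / (2 * k))

/-- The thermal mean particle number `N̄^Th_β[f]` at inverse temperature `β`. -/
noncomputable def Nth (β : ℝ) (f : ℝ → ℂ) : ℝ≥0∞ :=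
  ∫⁻ p in Set.Ioi (0:ℝ),
    ENNReal.ofReal (‖ft f p‖ ^ 2 / (2 * p * (Real.exp (β * p) - 1)))

/-- translate of `f` by `y₀`. -/
noncomputable def tr (f : ℝ → ℂ) (y₀ : ℝ) : ℝ → ℂ := fun y => f (y - y₀)

section
open FourierTransform Real SchwartzMap

theorem fourier_coe_ae_eq_of_integrable_of_memLp (f : ℝ → ℂ) (hf : Integrable f)
    (hf2 : MemLp f 2) :
    ((𝓕 (hf2.toLp f) : Lp ℂ 2 (volume : Measure ℝ)) : ℝ → ℂ) =ᵐ[volume] 𝓕 f := by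
  have hcont : Continuous (𝓕 f) :=
    VectorFourier.fourierIntegral_continuous Real.continuous_fourierChar
      (by fun_prop) hf
  refine ae_eq_of_integral_contDiff_smul_eq
    ((Lp.memLp _).locallyIntegrable (by norm_num)) hcont.locallyIntegrable ?_
  intro g g_smooth g_cpt
  have hg₁ : HasCompactSupport (Complex.ofRealCLM ∘ g) := g_cpt.comp_left rfl
  have hg₂ : ContDiff ℝ (⊤ : ℕ∞) (Complex.ofRealCLM ∘ g) := by fun_prop
  set φ : 𝓢(ℝ, ℂ) := hg₁.toSchwartzMap hg₂ with hφ
  have h1 := congrArg (fun T => T φ) (Lp.fourier_toTemperedDistribution_eq (hf2.toLp f))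
  simp only [TemperedDistribution.fourier_apply, Lp.toTemperedDistribution_apply] at h1
  have h2 : ∫ x, (𝓕 φ) x • (hf2.toLp f : ℝ → ℂ) x = ∫ x, (𝓕 φ) x • f x := by
    refine integral_congr_ae ?_
    filter_upwards [hf2.coeFn_toLp] with x hx
    rw [hx]
  have h3 := VectorFourier.integral_bilin_fourierIntegral_eq_flip (ContinuousLinearMap.mul ℂ ℂ)
    (μ := volume) (ν := volume) (L := innerₗ ℝ) Real.continuous_fourierChar
    (by fun_prop) φ.integrable hf
  rw [h2] at h1
  have e1 : ∀ x, g x • (𝓕 f) x = φ x • (𝓕 f) x := fun x => by simp [hφ]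
  have e2 : ∀ x, g x • (𝓕 (hf2.toLp f) : Lp ℂ 2 (volume : Measure ℝ)) x
      = φ x • (𝓕 (hf2.toLp f) : Lp ℂ 2 (volume : Measure ℝ)) x := fun x => by simp [hφ]
  simp_rw [e1, e2]
  rw [← h1]
  simp only [ContinuousLinearMap.mul_apply', flip_innerₗ] at h3
  exact h3

theorem lintegral_enorm_fourier_sq (f : ℝ → ℂ) (hf : Integrable f) (hf2 : MemLp f 2) :
    ∫⁻ p, ‖𝓕 f p‖ₑ ^ 2 = ∫⁻ y, ‖f y‖ₑ ^ 2 := by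
  have h := Lp.norm_fourier_eq (hf2.toLp f)
  have h' : eLpNorm (𝓕 f) 2 volume = eLpNorm f 2 volume := by
    rw [← eLpNorm_congr_ae (fourier_coe_ae_eq_of_integrable_of_memLp f hf hf2),
      ← Lp.enorm_def, ← eLpNorm_congr_ae hf2.coeFn_toLp, ← Lp.enorm_def,
      ← ofReal_norm, ← ofReal_norm, h]
  rw [eLpNorm_eq_lintegral_rpow_enorm_toReal (by norm_num) (by norm_num),
    eLpNorm_eq_lintegral_rpow_enorm_toReal (by norm_num) (by norm_num)] at h'
  simpa using ENNReal.rpow_left_injective (x := 1 / (2 : ℝ≥0∞).toReal) (by norm_num) h'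

end

open FourierTransform in
theorem plancherel_exp (f : ℝ → ℂ) (hf : Integrable f) (hf2 : MemLp f 2) :
    ∫⁻ p : ℝ, ‖∫ y : ℝ, f y * Complex.exp (-Complex.I * (p : ℂ) * (y : ℂ))‖ₑ ^ 2
      = ENNReal.ofReal (2 * Real.pi) * ∫⁻ y, ‖f y‖ₑ ^ 2 := by
  rw [← lintegral_enorm_fourier_sq f hf hf2]
  have h : ∀ p : ℝ, 𝓕 f p =
      ∫ y : ℝ, f y * Complex.exp (-Complex.I * ((2 * Real.pi * p : ℝ) : ℂ) * (y : ℂ)) := by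
    intro p
    rw [Real.fourier_eq']
    refine integral_congr_ae (ae_of_all _ fun y => ?_)
    simp only [smul_eq_mul]
    rw [mul_comm]
    congr 2
    simp
    ring
  simp_rw [h]
  set G : ℝ → ℝ≥0∞ :=
    fun q => ‖∫ y : ℝ, f y * Complex.exp (-Complex.I * (q : ℂ) * (y : ℂ))‖ₑ ^ 2
  change ∫⁻ q, G q = ENNReal.ofReal (2 * Real.pi) * ∫⁻ p, G (2 * Real.pi * p)
  rw [← (measurableEmbedding_mulLeft₀ (show 2 * Real.pi ≠ 0 by positivity)).lintegral_map G]
  conv_lhs => rw [← Real.smul_map_volume_mul_left (show 2 * Real.pi ≠ 0 by positivity)]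
  rw [lintegral_smul_measure, abs_of_pos (by positivity), smul_eq_mul]

/-- The plane wave `e^{-ipy}`. -/
noncomputable def planeWave (p y : ℝ) : ℂ := Complex.exp (-Complex.I * (p : ℂ) * (y : ℂ))

theorem norm_planeWave (p y : ℝ) : ‖planeWave p y‖ = 1 := by
  rw [planeWave, show -Complex.I * (p : ℂ) * (y : ℂ) = ((-(p * y) : ℝ) : ℂ) * Complex.I by
    push_cast; ring]
  exact Complex.norm_exp_ofReal_mul_I _

theorem planeWave_add (p y z : ℝ) : planeWave p (y + z) = planeWave p y * planeWave p z := by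
  rw [planeWave, planeWave, planeWave, ← Complex.exp_add]
  push_cast
  ring_nf

@[fun_prop]
theorem measurable_planeWave (p : ℝ) : Measurable (planeWave p) := by
  unfold planeWave
  fun_prop

/-- The convolution `∫ g(y) K(τ - x(y)) dμ(y)` of the push-forward of `g μ` along `x` with `K`. -/
noncomputable def pushConv (μ : Measure ℝ) (g : ℝ → ℂ) (x : ℝ → ℝ) (K : ℝ → ℂ) (τ : ℝ) : ℂ :=
  ∫ y, g y * K (τ - x y) ∂μ

section pushConv

variable {μ : Measure ℝ} {g : ℝ → ℂ} {x : ℝ → ℝ} {K : ℝ → ℂ}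

theorem integrable_pushConv_prod [SFinite μ] (hg : Integrable g μ) (hx : Measurable x)
    (hKm : Measurable K) (hK : Integrable K) :
    Integrable (fun q : ℝ × ℝ => g q.2 * K (q.1 - x q.2)) (volume.prod μ) := by
  have hm : AEStronglyMeasurable (fun q : ℝ × ℝ => g q.2 * K (q.1 - x q.2)) (volume.prod μ) := by
    refine hg.aestronglyMeasurable.comp_snd.mul (Measurable.aestronglyMeasurable ?_)
    fun_prop
  rw [integrable_prod_iff' hm]
  constructor
  · exact ae_of_all _ fun y => (hK.comp_sub_right (x y)).const_mul (g y)
  · have : ∀ y, ∫ τ, ‖g y * K (τ - x y)‖ = ‖g y‖ * ∫ τ, ‖K τ‖ := by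
      intro y
      simp_rw [norm_mul, integral_const_mul]
      rw [integral_sub_right_eq_self (fun τ => ‖K τ‖) (x y)]
    simp_rw [this]
    exact hg.norm.mul_const _

theorem integrable_pushConv [SFinite μ] (hg : Integrable g μ) (hx : Measurable x)
    (hKm : Measurable K) (hK : Integrable K) : Integrable (pushConv μ g x K) :=
  (integrable_pushConv_prod hg hx hKm hK).integral_prod_left

theorem norm_pushConv_le (hg : Integrable g μ) {B : ℝ} (hB : ∀ u, ‖K u‖ ≤ B) (τ : ℝ) :
    ‖pushConv μ g x K τ‖ ≤ (∫ y, ‖g y‖ ∂μ) * B := by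
  rw [← integral_mul_const]
  refine norm_integral_le_of_norm_le (hg.norm.mul_const B) (ae_of_all _ fun y => ?_)
  rw [norm_mul]
  exact mul_le_mul_of_nonneg_left (hB _) (norm_nonneg _)

theorem integral_pushConv_mul [SFinite μ] (hg : Integrable g μ) (hx : Measurable x)
    (hKm : Measurable K) (hK : Integrable K) {φ : ℝ → ℂ} (hφ : Measurable φ) {c : ℝ}
    (hc : ∀ u, ‖φ u‖ ≤ c) :
    ∫ τ, pushConv μ g x K τ * φ τ = ∫ y, g y * (∫ u, K u * φ (u + x y)) ∂μ := by
  have hi : Integrable (fun q : ℝ × ℝ => g q.2 * K (q.1 - x q.2) * φ q.1)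
      (volume.prod μ) :=
    (integrable_pushConv_prod hg hx hKm hK).mul_bdd (c := c)
      (Measurable.aestronglyMeasurable (by fun_prop)) (ae_of_all _ fun q => hc _)
  calc ∫ τ, pushConv μ g x K τ * φ τ
      = ∫ τ, ∫ y, g y * K (τ - x y) * φ τ ∂μ := by
        simp_rw [pushConv, integral_mul_const]
    _ = ∫ y, ∫ τ, g y * K (τ - x y) * φ τ ∂volume ∂μ := integral_integral_swap hi
    _ = _ := by
        congr 1
        ext y
        rw [← integral_const_mul,
          ← integral_sub_right_eq_self (fun u => g y * (K u * φ (u + x y))) (x y)]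
        simp only [sub_add_cancel, mul_assoc]

theorem integral_pushConv_mul_planeWave [SFinite μ] (hg : Integrable g μ) (hx : Measurable x)
    (hKm : Measurable K) (hK : Integrable K) (p : ℝ) :
    ∫ τ, pushConv μ g x K τ * planeWave p τ =
      (∫ y, g y * planeWave p (x y) ∂μ) * ∫ u, K u * planeWave p u := by
  rw [integral_pushConv_mul hg hx hKm hK (measurable_planeWave p) fun u => (norm_planeWave p u).le,
    ← integral_mul_const]
  congr 1
  ext y
  have h : ∀ u, K u * planeWave p (u + x y) = planeWave p (x y) * (K u * planeWave p u) := by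
    intro u
    rw [planeWave_add]
    ring
  simp_rw [h, integral_const_mul, mul_assoc]

theorem setIntegral_Iic_pushConv [SFinite μ] (hg : Integrable g μ) (hx : Measurable x)
    (hKm : Measurable K) (hK : Integrable K) (τ : ℝ) :
    ∫ σ in Iic τ, pushConv μ g x K σ = ∫ y, g y * (∫ u in Iic (τ - x y), K u) ∂μ := by
  have h := integral_pushConv_mul hg hx hKm hK (φ := (Iic τ).indicator 1)
    (measurable_one.indicator measurableSet_Iic) (c := 1) fun u => by
      by_cases hu : u ∈ Iic τ <;> simp [hu]
  rw [← integral_indicator measurableSet_Iic]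
  convert h using 1
  · congr 1
    ext σ
    by_cases hσ : σ ∈ Iic τ <;> simp [hσ]
  · congr 1
    ext y
    rw [← integral_indicator measurableSet_Iic]
    congr 2
    ext u
    by_cases hu : u ≤ τ - x y
    · simp [hu, show u + x y ≤ τ by linarith]
    · simp [hu, show ¬ u + x y ≤ τ by intro h; apply hu; linarith]

theorem lintegral_enorm_pushConv_sq [SFinite μ] (hg : Integrable g μ) (hx : Measurable x)
    (hKm : Measurable K) (hK : Integrable K) {B : ℝ} (hB : ∀ u, ‖K u‖ ≤ B) :
    ENNReal.ofReal (2 * Real.pi) * ∫⁻ τ, ‖pushConv μ g x K τ‖ₑ ^ 2 =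
      ∫⁻ p, ‖(∫ y, g y * planeWave p (x y) ∂μ) * ∫ u, K u * planeWave p u‖ₑ ^ 2 := by
  have hT := integrable_pushConv hg hx hKm hK
  have h2 : MemLp (pushConv μ g x K) 2 := by
    rw [memLp_two_iff_integrable_sq_norm hT.aestronglyMeasurable]
    refine (hT.norm.const_mul ((∫ y, ‖g y‖ ∂μ) * B)).mono'
      (hT.aestronglyMeasurable.norm.pow 2) (ae_of_all _ fun τ => ?_)
    rw [Real.norm_of_nonneg (sq_nonneg _), sq]
    exact mul_le_mul_of_nonneg_right (norm_pushConv_le hg hB τ) (norm_nonneg _)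
  rw [← plancherel_exp _ hT h2]
  simp_rw [← integral_pushConv_mul_planeWave hg hx hKm hK]
  rfl

end pushConv

open scoped Topology RealInnerProductSpace in
theorem lintegral_enorm_sq_le_of_eq_add_integral_Iic {U X : ℝ → ℂ} (hUc : Continuous U)
    (hU : Integrable U) {B : ℝ} (hB : ∀ τ, ‖U τ‖ ≤ B) {c : ℝ} (hc0 : 0 < c)
    (hX : ∀ τ, X τ = U τ + c * ∫ σ in Iic τ, U σ) :
    ∫⁻ τ, ‖U τ‖ₑ ^ 2 ≤ ∫⁻ τ, ‖X τ‖ₑ ^ 2 := by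
  have hc := hc0.le
  by_cases htop : ∫⁻ τ, ‖X τ‖ₑ ^ 2 = ∞
  · rw [htop]; exact le_top
  set V : ℝ → ℂ := fun τ => c * ∫ σ in Iic τ, U σ with hV
  have hVd : ∀ τ, HasDerivAt V (c * U τ) τ := by
    intro τ
    have h1 : ∀ t, V t = c * ((∫ σ in Iic 0, U σ) + ∫ σ in (0:ℝ)..t, U σ) := by
      intro t
      rw [← intervalIntegral.integral_Iic_sub_Iic hU.integrableOn hU.integrableOn]
      simp [hV]
    rw [funext h1]
    exact ((intervalIntegral.integral_hasDerivAt_right (hU.intervalIntegrable)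
      (hUc.stronglyMeasurableAtFilter _ _) hUc.continuousAt).const_add _).const_mul _
  have hVc : Continuous V := continuous_iff_continuousAt.2 fun τ => (hVd τ).continuousAt
  have hVb : ∀ τ, ‖V τ‖ ≤ |c| * ∫ σ, ‖U σ‖ := by
    intro τ
    rw [hV]
    simp only [norm_mul, Complex.norm_real, Real.norm_eq_abs]
    refine mul_le_mul_of_nonneg_left ((norm_integral_le_integral_norm _).trans ?_) (abs_nonneg _)
    exact setIntegral_le_integral hU.norm (ae_of_all _ fun _ => norm_nonneg _)
  have hbot : Tendsto V atBot (𝓝 0) := by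
    have := (tendsto_integral_Iic_zero (f := U) (μ := volume) tendsto_id).const_mul (c : ℂ)
    simpa using this
  have htopV : Tendsto V atTop (𝓝 (c * ∫ σ, U σ)) := by
    exact ((aecover_Iic (μ := volume) tendsto_id).integral_tendsto_of_countably_generated
      hU).const_mul (c : ℂ)
  have hin : Integrable (fun τ => 2 * ⟪V τ, c * U τ⟫) := by
    refine (hU.norm.const_mul (2 * ((|c| * ∫ σ, ‖U σ‖) * |c|))).mono'
      (Continuous.aestronglyMeasurable (by fun_prop)) (ae_of_all _ fun τ => ?_)
    rw [norm_mul]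
    have h1 := norm_inner_le_norm (𝕜 := ℝ) (V τ) (c * U τ)
    rw [norm_mul (c : ℂ) (U τ), Complex.norm_real] at h1
    have h2 := mul_le_mul_of_nonneg_right (hVb τ)
      (show 0 ≤ ‖c‖ * ‖U τ‖ by positivity)
    rw [Real.norm_eq_abs, Real.norm_eq_abs] at *
    rw [Nat.abs_ofNat]
    linarith
  have hint : ∫ τ, 2 * ⟪V τ, c * U τ⟫ = ‖c * ∫ σ, U σ‖ ^ 2 - ‖(0:ℂ)‖ ^ 2 :=
    integral_of_hasDerivAt_of_tendsto (f := fun τ => ‖V τ‖ ^ 2) (fun τ => (hVd τ).norm_sq) hin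
      (hbot.norm.pow 2) (htopV.norm.pow 2)
  have hXc : Continuous X := by
    rw [show X = fun τ => U τ + V τ from funext hX]
    exact hUc.add hVc
  have hU2 : Integrable (fun τ => ‖U τ‖ ^ 2) := by
    refine (hU.norm.const_mul B).mono' (hUc.norm.pow 2).aestronglyMeasurable
      (ae_of_all _ fun τ => ?_)
    rw [Real.norm_of_nonneg (sq_nonneg _), sq]
    exact mul_le_mul_of_nonneg_right (hB τ) (norm_nonneg _)
  have hX2 : Integrable (fun τ => ‖X τ‖ ^ 2) := by
    refine ⟨(hXc.norm.pow 2).aestronglyMeasurable, ?_⟩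
    rw [HasFiniteIntegral]
    simpa using lt_top_iff_ne_top.2 htop
  have key : c * ∫ τ, ‖U τ‖ ^ 2 ≤ c * ∫ τ, ‖X τ‖ ^ 2 := by
    have h2 : ∫ τ, 2 * ⟪V τ, c * U τ⟫ ≤ ∫ τ, (c * ‖X τ‖ ^ 2 - c * ‖U τ‖ ^ 2) := by
      refine integral_mono hin ((hX2.const_mul c).sub (hU2.const_mul c)) fun τ => ?_
      have h3 : ‖X τ‖ ^ 2 = ‖U τ‖ ^ 2 + 2 * ⟪U τ, V τ⟫ + ‖V τ‖ ^ 2 := by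
        rw [hX τ]
        exact norm_add_sq_real (U τ) (V τ)
      have h4 : ⟪V τ, c * U τ⟫ = c * ⟪U τ, V τ⟫ := by
        rw [← Complex.real_smul, inner_smul_right, real_inner_comm]
      simp only [h3, h4]
      have := mul_nonneg hc (sq_nonneg ‖V τ‖)
      nlinarith
    rw [integral_sub (hX2.const_mul c) (hU2.const_mul c), hint, integral_const_mul,
      integral_const_mul] at h2
    have : 0 ≤ ‖c * ∫ σ, U σ‖ ^ 2 - ‖(0:ℂ)‖ ^ 2 := by
      rw [norm_zero, zero_pow two_ne_zero, sub_zero]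
      positivity
    linarith
  have key' := le_of_mul_le_mul_left key hc0
  have e : ∀ z : ℂ, ‖z‖ₑ ^ 2 = ENNReal.ofReal (‖z‖ ^ 2) := fun z => by
    rw [ENNReal.ofReal_pow (norm_nonneg _), ofReal_norm]
  simp_rw [e]
  rw [← ofReal_integral_eq_lintegral_ofReal hU2 (ae_of_all _ fun _ => sq_nonneg _),
    ← ofReal_integral_eq_lintegral_ofReal hX2 (ae_of_all _ fun _ => sq_nonneg _)]
  exact ENNReal.ofReal_le_ofReal key'

open scoped Topology in
theorem tendsto_lintegral_enorm_sq {β : Type*} [MeasurableSpace β] {ν : Measure β}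
    {φ : ℕ → β → ℂ} {ψ : β → ℂ} (hm : ∀ n, AEStronglyMeasurable (φ n) ν)
    (hle : ∀ n, ∫⁻ b, ‖φ n b‖ₑ ^ 2 ∂ν ≤ ∫⁻ b, ‖ψ b‖ₑ ^ 2 ∂ν)
    (hlim : ∀ᵐ b ∂ν, Tendsto (fun n => φ n b) atTop (𝓝 (ψ b))) :
    Tendsto (fun n => ∫⁻ b, ‖φ n b‖ₑ ^ 2 ∂ν) atTop (𝓝 (∫⁻ b, ‖ψ b‖ₑ ^ 2 ∂ν)) := by
  refine tendsto_of_le_liminf_of_limsup_le ?_ ?_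
  · calc ∫⁻ b, ‖ψ b‖ₑ ^ 2 ∂ν = ∫⁻ b, liminf (fun n => ‖φ n b‖ₑ ^ 2) atTop ∂ν := by
          refine lintegral_congr_ae ?_
          filter_upwards [hlim] with b hb
          exact ((ENNReal.continuous_pow 2).tendsto _ |>.comp hb.enorm).liminf_eq.symm
      _ ≤ _ := lintegral_liminf_le' fun n => (hm n).enorm.pow_const 2
  · exact (limsup_le_limsup (Eventually.of_forall hle)).trans (limsup_const _).le

theorem continuous_integral_mul_planeWave {μ : Measure ℝ} {g : ℝ → ℂ} {x : ℝ → ℝ}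
    (hg : Integrable g μ) (hx : Measurable x) :
    Continuous fun p => ∫ y, g y * planeWave p (x y) ∂μ := by
  refine continuous_of_dominated (bound := fun y => ‖g y‖) (fun p => ?_) (fun p => ?_) hg.norm ?_
  · exact hg.aestronglyMeasurable.mul (Measurable.aestronglyMeasurable (by fun_prop))
  · exact ae_of_all _ fun y => by rw [norm_mul, norm_planeWave, mul_one]
  · refine ae_of_all _ fun y => ?_
    unfold planeWave
    fun_prop

/-- The causal exponential kernel `1_{u ≥ 0} e^{-cu}`. -/
noncomputable def expKernel (c : ℝ) : ℝ → ℂ := (Ici 0).indicator fun u => Complex.exp (-(c * u))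

theorem measurable_expKernel (c : ℝ) : Measurable (expKernel c) :=
  Measurable.indicator (by fun_prop) measurableSet_Ici

theorem norm_expKernel_le {c : ℝ} (hc : 0 ≤ c) (u : ℝ) : ‖expKernel c u‖ ≤ 1 := by
  by_cases hu : 0 ≤ u
  · have : -(c * u) ≤ 0 := by nlinarith
    simpa [expKernel, hu, Complex.norm_exp] using mul_nonneg hc hu
  · simp [expKernel, hu]

theorem integrable_expKernel {c : ℝ} (hc : 0 < c) : Integrable (expKernel c) := by
  rw [expKernel, integrable_indicator_iff measurableSet_Ici, integrableOn_Ici_iff_integrableOn_Ioi]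
  simpa [neg_mul] using integrableOn_exp_mul_complex_Ioi (a := -(c : ℂ)) (by simpa using hc) 0

theorem integral_expKernel_mul_planeWave {c : ℝ} (hc : 0 < c) (p : ℝ) :
    ∫ u, expKernel c u * planeWave p u = (c + Complex.I * p)⁻¹ := by
  have h : (fun u => expKernel c u * planeWave p u) =
      (Ici 0).indicator fun u : ℝ => Complex.exp (-(c + Complex.I * p) * u) := by
    ext u
    by_cases hu : 0 ≤ u
    · simp only [expKernel, planeWave, hu, mem_Ici, indicator_of_mem, ← Complex.exp_add]
      ring_nf
    · simp [expKernel, hu]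
  rw [h, integral_indicator measurableSet_Ici, integral_Ici_eq_integral_Ioi,
    integral_exp_mul_complex_Ioi (by simpa using hc)]
  rw [← neg_div_neg_eq]
  simp

theorem mul_setIntegral_Iic_expKernel {c : ℝ} (hc : 0 < c) (t : ℝ) :
    c * ∫ u in Iic t, expKernel c u = expKernel 0 t - expKernel c t := by
  have h : ∫ u in Iic t, expKernel c u = ∫ u in Icc 0 t, Complex.exp (-c * u) := by
    rw [expKernel, setIntegral_indicator measurableSet_Ici, inter_comm, Ici_inter_Iic]
    simp
  rw [h, integral_Icc_eq_integral_Ioc]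
  by_cases ht : 0 ≤ t
  · rw [← intervalIntegral.integral_of_le ht, integral_exp_mul_complex (by simpa using hc.ne')]
    have : (c : ℂ) ≠ 0 := by simpa using hc.ne'
    simp only [expKernel, mem_Ici, ht, indicator_of_mem]
    field_simp
    simp
  · rw [Ioc_eq_empty (by linarith)]
    simp [expKernel, ht]

section

variable {μ : Measure ℝ} {g : ℝ → ℂ} {x : ℝ → ℝ}

open scoped Topology in
theorem continuous_pushConv_expKernel [NullSingletonClass μ] (hg : Integrable g μ) (hx : Measurable x)
    (hinj : Function.Injective x) {c : ℝ} (hc : 0 ≤ c) :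
    Continuous (pushConv μ g x (expKernel c)) := by
  rw [continuous_iff_continuousAt]
  intro τ₀
  refine continuousAt_of_dominated (bound := fun y => ‖g y‖) (Eventually.of_forall fun τ => ?_)
    (Eventually.of_forall fun τ => ae_of_all _ fun y => ?_) hg.norm ?_
  · exact hg.aestronglyMeasurable.mul ((measurable_expKernel c).comp
      (measurable_const.sub hx)).aestronglyMeasurable
  · rw [norm_mul]
    exact mul_le_of_le_one_right (norm_nonneg _) (norm_expKernel_le hc _)
  · have h0 : μ {y | x y = τ₀} = 0 :=
      Set.Subsingleton.measure_zero (fun a ha b hb => hinj (ha.trans hb.symm)) _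
    filter_upwards [compl_mem_ae_iff.2 h0] with y hy
    have hy' : τ₀ - x y ≠ 0 := fun h => hy (by simp; linarith)
    refine continuousAt_const.mul (ContinuousAt.comp' (g := expKernel c) ?_ (by fun_prop))
    rcases hy'.lt_or_gt with h | h
    · refine (continuousAt_const (y := (0 : ℂ))).congr ?_
      filter_upwards [Iio_mem_nhds h] with u hu
      simp [expKernel, not_le.2 (mem_Iio.1 hu)]
    · refine ContinuousAt.congr (f := fun u : ℝ => Complex.exp (-(c * u))) (by fun_prop) ?_
      filter_upwards [Ioi_mem_nhds h] with u hu
      simp [expKernel, (mem_Ioi.1 hu).le]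

theorem lintegral_enorm_pushConv_expKernel_le [SFinite μ] [NullSingletonClass μ] (hg : Integrable g μ)
    (hx : Measurable x) (hinj : Function.Injective x) {c : ℝ} (hc : 0 < c) :
    ∫⁻ τ, ‖pushConv μ g x (expKernel c) τ‖ₑ ^ 2 ≤
      ∫⁻ τ, ‖pushConv μ g x (expKernel 0) τ‖ₑ ^ 2 := by
  refine lintegral_enorm_sq_le_of_eq_add_integral_Iic
    (continuous_pushConv_expKernel hg hx hinj hc.le)
    (integrable_pushConv hg hx (measurable_expKernel c) (integrable_expKernel hc))
    (norm_pushConv_le hg (norm_expKernel_le hc.le)) hc fun τ => ?_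
  rw [setIntegral_Iic_pushConv hg hx (measurable_expKernel c) (integrable_expKernel hc),
    ← integral_const_mul]
  have hi : ∀ c : ℝ, 0 ≤ c → Integrable (fun y => g y * expKernel c (τ - x y)) μ := fun c hc =>
    hg.mul_bdd (c := 1) ((measurable_expKernel c).comp
      (measurable_const.sub hx)).aestronglyMeasurable
      (ae_of_all _ fun y => norm_expKernel_le hc _)
  have h : ∀ y, c * (g y * ∫ u in Iic (τ - x y), expKernel c u) =
      g y * expKernel 0 (τ - x y) - g y * expKernel c (τ - x y) := fun y => by
    rw [mul_left_comm, mul_setIntegral_Iic_expKernel hc, mul_sub]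
  simp_rw [h]
  rw [integral_sub (hi 0 le_rfl) (hi c hc.le)]
  simp [pushConv]

open scoped Topology in
theorem lintegral_enorm_pushConv_heaviside_sq [SFinite μ] [NullSingletonClass μ] (hg : Integrable g μ)
    (hx : Measurable x) (hinj : Function.Injective x) :
    ENNReal.ofReal (2 * Real.pi) * ∫⁻ τ, ‖pushConv μ g x (expKernel 0) τ‖ₑ ^ 2 =
      ∫⁻ p : ℝ, ‖(∫ y, g y * planeWave p (x y) ∂μ) * (Complex.I * p)⁻¹‖ₑ ^ 2 := by
  have hc : ∀ n : ℕ, (0 : ℝ) < 1 / ((n : ℝ) + 1) := fun n => by positivity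
  have hc0 : Tendsto (fun n : ℕ => 1 / ((n : ℝ) + 1)) atTop (𝓝 0) :=
    tendsto_one_div_add_atTop_nhds_zero_nat
  have h1 : Tendsto (fun n : ℕ => ∫⁻ τ, ‖pushConv μ g x (expKernel (1 / ((n : ℝ) + 1))) τ‖ₑ ^ 2)
      atTop (𝓝 (∫⁻ τ, ‖pushConv μ g x (expKernel 0) τ‖ₑ ^ 2)) := by
    refine tendsto_lintegral_enorm_sq (fun n =>
        (continuous_pushConv_expKernel hg hx hinj (hc n).le).aestronglyMeasurable)
      (fun n => lintegral_enorm_pushConv_expKernel_le hg hx hinj (hc n)) (ae_of_all _ fun τ => ?_)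
    refine tendsto_integral_of_dominated_convergence (fun y => ‖g y‖) (fun n => ?_) hg.norm
      (fun n => ae_of_all _ fun y => ?_) (ae_of_all _ fun y => ?_)
    · exact hg.aestronglyMeasurable.mul ((measurable_expKernel _).comp
        (measurable_const.sub hx)).aestronglyMeasurable
    · rw [norm_mul]
      exact mul_le_of_le_one_right (norm_nonneg _) (norm_expKernel_le (hc n).le _)
    · refine Tendsto.const_mul _ ?_
      by_cases hu : 0 ≤ τ - x y
      · simp only [expKernel, mem_Ici, hu, indicator_of_mem]
        refine (Continuous.tendsto (f := fun c : ℝ => Complex.exp (-(c * (τ - x y : ℝ))))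
          (by fun_prop) 0).comp hc0
      · simp [expKernel, hu]
  have h2 : Tendsto (fun n : ℕ => ∫⁻ p : ℝ, ‖(∫ y, g y * planeWave p (x y) ∂μ) *
      ((1 / ((n : ℝ) + 1) : ℝ) + Complex.I * p)⁻¹‖ₑ ^ 2) atTop
      (𝓝 (∫⁻ p : ℝ, ‖(∫ y, g y * planeWave p (x y) ∂μ) * (Complex.I * p)⁻¹‖ₑ ^ 2)) := by
    refine tendsto_lintegral_enorm_sq (fun n => ?_) (fun n => ?_) ?_
    · exact (continuous_integral_mul_planeWave hg hx).aestronglyMeasurable.mul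
        (Measurable.aestronglyMeasurable (by fun_prop))
    · refine lintegral_mono_ae ?_
      filter_upwards [Measure.ae_ne volume 0] with p hp
      gcongr
      rw [enorm_mul, enorm_mul]
      gcongr
      rw [← ofReal_norm, ← ofReal_norm, norm_inv, norm_inv]
      refine ENNReal.ofReal_le_ofReal (inv_anti₀ (by simpa using hp) ?_)
      refine le_of_eq_of_le ?_ (Complex.abs_im_le_norm _)
      simp
    · filter_upwards [Measure.ae_ne volume 0] with p hp
      refine Tendsto.const_mul _ (Tendsto.inv₀ ?_ (by simpa using hp))
      have := ((Complex.continuous_ofReal.tendsto 0).comp hc0).add_const (Complex.I * p)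
      simpa using this
  refine tendsto_nhds_unique (ENNReal.Tendsto.const_mul h1 (Or.inr ENNReal.ofReal_ne_top)) ?_
  refine h2.congr fun n => ?_
  rw [lintegral_enorm_pushConv_sq hg hx (measurable_expKernel _) (integrable_expKernel (hc n))
    (norm_expKernel_le (hc n).le)]
  simp_rw [integral_expKernel_mul_planeWave (hc n)]

end

theorem integrableOn_cpow_mul_cexp_neg_mul_Ioi {a z : ℂ} (ha : 0 < a.re) (hz : 0 < z.re) :
    IntegrableOn (fun t : ℝ => (t : ℂ) ^ (a - 1) * Complex.exp (-(z * t))) (Ioi 0) := by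
  have h := integrableOn_rpow_mul_exp_neg_mul_rpow (p := 1) (s := a.re - 1) (b := z.re)
    (by linarith) one_pos hz
  refine h.mono' ?_ ?_
  · refine (ContinuousOn.mul ?_ (by fun_prop)).aestronglyMeasurable measurableSet_Ioi
    exact continuousOn_of_forall_continuousAt fun t ht =>
      (Complex.continuousAt_ofReal_cpow_const _ _ (Or.inr (ne_of_gt ht)))
  · filter_upwards [ae_restrict_mem measurableSet_Ioi] with t ht
    rw [norm_mul, Complex.norm_cpow_eq_rpow_re_of_pos ht, Complex.norm_exp]
    simp

theorem integral_cpow_mul_cexp_neg_mul_Ioi {a z : ℂ} (ha : 0 < a.re) (hz : 0 < z.re) :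
    ∫ t : ℝ in Ioi 0, (t : ℂ) ^ (a - 1) * Complex.exp (-(z * t)) =
      (1 / z) ^ a * Complex.Gamma a := by
  set H : Set ℂ := {z | 0 < z.re} with hH
  have hHo : IsOpen H := isOpen_lt continuous_const Complex.continuous_re
  have hHc : IsPreconnected H := (convex_halfSpace_re_gt 0).isPreconnected
  have h1 : DifferentiableOn ℂ
      (fun z : ℂ => ∫ t : ℝ in Ioi 0, (t : ℂ) ^ (a - 1) * Complex.exp (-(z * t))) H := by
    intro w hw
    have hw' : 0 < w.re := hw
    have hb : 0 < w.re / 2 := by linarith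
    have key := hasDerivAt_integral_of_dominated_loc_of_deriv_le (𝕜 := ℂ)
      (μ := volume.restrict (Ioi (0 : ℝ)))
      (F := fun (z : ℂ) (t : ℝ) => (t : ℂ) ^ (a - 1) * Complex.exp (-(z * t)))
      (F' := fun (z : ℂ) (t : ℝ) => (t : ℂ) ^ (a - 1) * (Complex.exp (-(z * t)) * (-t)))
      (x₀ := w) (s := Metric.ball w (w.re / 2))
      (bound := fun t : ℝ => t ^ a.re * Real.exp (-(w.re / 2) * t ^ (1 : ℝ)))
      (Metric.ball_mem_nhds w hb) ?_ (integrableOn_cpow_mul_cexp_neg_mul_Ioi ha hw) ?_ ?_ ?_ ?_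
    · exact key.2.differentiableAt.differentiableWithinAt
    · filter_upwards [hHo.mem_nhds hw] with z hz
      exact (integrableOn_cpow_mul_cexp_neg_mul_Ioi ha hz).aestronglyMeasurable
    · refine (ContinuousOn.mul ?_ (by fun_prop)).aestronglyMeasurable measurableSet_Ioi
      exact continuousOn_of_forall_continuousAt fun t ht =>
        (Complex.continuousAt_ofReal_cpow_const _ _ (Or.inr (ne_of_gt ht)))
    · filter_upwards [ae_restrict_mem measurableSet_Ioi] with t ht z hz
      have ht' : 0 < t := ht
      have hz' : w.re / 2 ≤ z.re := by
        have := (Complex.abs_re_le_norm (z - w)).trans (mem_ball_iff_norm.1 hz).le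
        rw [Complex.sub_re] at this
        have := (abs_le.1 this).1
        linarith
      rw [norm_mul, norm_mul, Complex.norm_cpow_eq_rpow_re_of_pos ht, Complex.norm_exp]
      rw [Real.rpow_one, norm_neg, Complex.norm_real, Real.norm_of_nonneg ht'.le]
      have e : t ^ a.re = t ^ (a - 1).re * t := by
        rw [Complex.sub_re, Complex.one_re, Real.rpow_sub_one ht'.ne']
        field_simp
      rw [e, mul_assoc, mul_comm t]
      gcongr
      simp
      nlinarith
    · exact integrableOn_rpow_mul_exp_neg_mul_rpow (by linarith) one_pos hb
    · refine ae_of_all _ fun t z _ => ?_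
      have : HasDerivAt (fun z : ℂ => -(z * t)) (-t) z := by
        simpa using (hasDerivAt_mul_const (t : ℂ) (x := z)).fun_neg
      exact (this.cexp).const_mul _
  have h2 : DifferentiableOn ℂ (fun z : ℂ => (1 / z) ^ a * Complex.Gamma a) H := by
    intro w hw
    have hw' : 0 < w.re := hw
    have hw0 : w ≠ 0 := fun h => by simp [h] at hw'
    refine DifferentiableAt.differentiableWithinAt (DifferentiableAt.mul_const ?_ _)
    refine DifferentiableAt.cpow_const ?_ (Or.inl ?_)
    · exact (differentiableAt_const _).div differentiableAt_id hw0
    · rw [one_div, Complex.inv_re]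
      exact div_pos hw' (Complex.normSq_pos.2 hw0)
  refine (h1.analyticOnNhd hHo).eqOn_of_preconnected_of_frequently_eq (h2.analyticOnNhd hHo) hHc
    (z₀ := 1) (by simp [hH]) ?_ hz
  have ht : Tendsto (fun n : ℕ => ((1 + 1 / ((n : ℝ) + 1) : ℝ) : ℂ)) atTop (nhdsWithin 1 {1}ᶜ) := by
    refine tendsto_nhdsWithin_iff.2 ⟨?_, Eventually.of_forall fun n => ?_⟩
    · have := (Complex.continuous_ofReal.tendsto _).comp
        ((tendsto_one_div_add_atTop_nhds_zero_nat (𝕜 := ℝ)).const_add 1)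
      simpa [Function.comp_def] using this
    · have : (0 : ℝ) < 1 / ((n : ℝ) + 1) := by positivity
      rw [mem_compl_singleton_iff, ← Complex.ofReal_one, Ne, Complex.ofReal_inj]
      linarith
  refine ht.frequently (Frequently.of_forall fun n => ?_)
  exact Complex.integral_cpow_mul_exp_neg_mul_Ioi ha (by positivity)

open ProbabilityTheory in
theorem integral_gammaMeasure {a r : ℝ} (ha : 0 < a) (hr : 0 < r) (h : ℝ → ℂ) :
    ∫ v, h v ∂gammaMeasure a r =
      ∫ v in Ioi 0, (r ^ a / Real.Gamma a * v ^ (a - 1) * Real.exp (-(r * v)) : ℝ) * h v := by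
  have hG := Real.Gamma_pos_of_pos ha
  rw [gammaMeasure, integral_withDensity_eq_integral_toReal_smul (f := gammaPDF a r)
    (measurable_gammaPDFReal a r).ennreal_ofReal
    (ae_of_all _ fun v => (ENNReal.ofReal_lt_top : gammaPDF a r v < ∞)), ← integral_Ici_eq_integral_Ioi,
    ← integral_indicator measurableSet_Ici]
  congr 1
  ext v
  by_cases hv : 0 ≤ v
  · have : 0 ≤ r ^ a / Real.Gamma a * v ^ (a - 1) * Real.exp (-(r * v)) := by positivity
    rw [gammaPDF_of_nonneg hv, ENNReal.toReal_ofReal this]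
    simp only [mem_Ici, hv, indicator_of_mem, Complex.real_smul]
  · simp [gammaPDF_of_neg (not_le.1 hv), hv]

open ProbabilityTheory in
theorem ae_pos_gammaMeasure (a r : ℝ) : ∀ᵐ v ∂gammaMeasure a r, 0 < v := by
  rw [gammaMeasure, ae_withDensity_iff (f := gammaPDF a r)
    (measurable_gammaPDFReal a r).ennreal_ofReal]
  filter_upwards [Measure.ae_ne volume 0] with v hv h
  by_contra h'
  exact h (gammaPDF_of_neg (lt_of_le_of_ne (not_lt.1 h') hv))

open ProbabilityTheory in
theorem integral_cpow_mul_cexp_gammaMeasure {a : ℝ} {s z : ℂ} (ha : 0 < a)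
    (hs : 0 < (a + s).re) (hz : 0 < (a + z).re) :
    ∫ v : ℝ, (v : ℂ) ^ s * Complex.exp (-(z * v)) ∂gammaMeasure a a =
      (a : ℂ) ^ (a : ℂ) / Complex.Gamma a * ((1 / (a + z)) ^ (a + s) * Complex.Gamma (a + s)) := by
  rw [← integral_cpow_mul_cexp_neg_mul_Ioi hs hz, integral_gammaMeasure ha ha,
    ← integral_const_mul]
  refine setIntegral_congr_fun measurableSet_Ioi fun v hv => ?_
  have hv' : (0 : ℝ) < v := hv
  have hv0 : (v : ℂ) ≠ 0 := by simpa using hv'.ne'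
  rw [show (a : ℂ) + s - 1 = (a - 1) + s by ring, Complex.cpow_add _ _ hv0,
    show -((a + z) * (v : ℂ)) = -(a * v) + -(z * v) by ring, Complex.exp_add]
  push_cast
  rw [Complex.ofReal_cpow ha.le, Complex.ofReal_cpow hv'.le, ← Complex.Gamma_ofReal]
  push_cast
  ring

theorem natCast_div_pow (n : ℕ) (hn : n ≠ 0) (z : ℂ) (m : ℕ) :
    (n : ℂ) ^ m * (1 / (n + z)) ^ m = ((1 + z / n) ^ m)⁻¹ := by
  have : (n : ℂ) ≠ 0 := by exact_mod_cast hn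
  rw [← mul_pow, ← inv_pow]
  congr 1
  field_simp

open ProbabilityTheory in
theorem integral_cexp_gammaMeasure {n : ℕ} (hn : n ≠ 0) {z : ℂ} (hz : 0 ≤ z.re) :
    ∫ v : ℝ, Complex.exp (-(z * v)) ∂gammaMeasure n n = ((1 + z / n) ^ n)⁻¹ := by
  have hn0 : (0 : ℝ) < n := by positivity
  have hG : Complex.Gamma n ≠ 0 := by
    rw [← Complex.ofReal_natCast, Complex.Gamma_ofReal]
    exact_mod_cast (Real.Gamma_pos_of_pos hn0).ne'
  have h := integral_cpow_mul_cexp_gammaMeasure (s := 0) (z := z) hn0 (by simpa using hn0)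
    (by simp; positivity)
  simp only [Complex.cpow_zero, one_mul, add_zero, Complex.ofReal_natCast,
    Complex.cpow_natCast] at h
  rw [h, ← natCast_div_pow n hn z n]
  field_simp

open ProbabilityTheory in
theorem integral_mul_cexp_gammaMeasure {n : ℕ} (hn : n ≠ 0) {z : ℂ} (hz : 0 ≤ z.re) :
    ∫ v : ℝ, v * Complex.exp (-(z * v)) ∂gammaMeasure n n = ((1 + z / n) ^ (n + 1))⁻¹ := by
  have hn0 : (0 : ℝ) < n := by positivity
  have hn1 : (n : ℂ) ≠ 0 := by exact_mod_cast hn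
  have hG : Complex.Gamma n ≠ 0 := by
    rw [← Complex.ofReal_natCast, Complex.Gamma_ofReal]
    exact_mod_cast (Real.Gamma_pos_of_pos hn0).ne'
  have h := integral_cpow_mul_cexp_gammaMeasure (s := 1) (z := z) hn0 (by simp; positivity)
    (by simp; positivity)
  have hp : (1 / ((n : ℂ) + z)) ^ ((n : ℂ) + 1) = (1 / ((n : ℂ) + z)) ^ (n + 1) := by
    exact_mod_cast Complex.cpow_natCast (1 / ((n : ℂ) + z)) (n + 1)
  simp only [Complex.cpow_one, Complex.ofReal_natCast, Complex.cpow_natCast] at h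
  rw [h, ← natCast_div_pow n hn z (n + 1), Complex.Gamma_add_one _ hn1, hp]
  field_simp
  ring

theorem image_exp_univ : Real.exp '' univ = Ioi 0 := by
  rw [image_univ, Real.range_exp]

theorem integral_exp_smul_comp_exp (F : ℝ → ℂ) :
    ∫ u : ℝ, Real.exp u * F (Real.exp u) = ∫ v in Ioi 0, F v := by
  rw [← image_exp_univ, integral_image_eq_integral_abs_deriv_smul MeasurableSet.univ
    (fun u _ => (Real.hasDerivAt_exp u).hasDerivWithinAt) Real.exp_injective.injOn]
  simp [Real.abs_exp]

theorem integrable_exp_smul_comp_exp {F : ℝ → ℂ} (hF : IntegrableOn F (Ioi 0)) :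
    Integrable fun u : ℝ => (Real.exp u : ℂ) * F (Real.exp u) := by
  rw [← image_exp_univ, integrableOn_image_iff_integrableOn_abs_deriv_smul MeasurableSet.univ
    (fun u _ => (Real.hasDerivAt_exp u).hasDerivWithinAt) Real.exp_injective.injOn] at hF
  simpa [Real.abs_exp] using hF

/-- The derivative of `u ↦ exp (-r e^u)`. -/
noncomputable def gumbelKernel (r : ℂ) (u : ℝ) : ℂ :=
  Real.exp u * (-r * Complex.exp (-(r * (Real.exp u : ℝ))))

theorem measurable_gumbelKernel (r : ℂ) : Measurable (gumbelKernel r) := by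
  unfold gumbelKernel
  fun_prop

theorem integrable_gumbelKernel {r : ℂ} (hr : 0 < r.re) : Integrable (gumbelKernel r) := by
  have h := integrableOn_cpow_mul_cexp_neg_mul_Ioi (a := 1) (z := r) (by simp) hr
  simp only [sub_self, Complex.cpow_zero, one_mul] at h
  exact integrable_exp_smul_comp_exp (h.const_mul (-r))

theorem planeWave_eq_cpow (p u : ℝ) :
    planeWave p u = (Real.exp u : ℂ) ^ (-(Complex.I * p)) := by
  rw [Complex.cpow_def_of_ne_zero (by exact_mod_cast (Real.exp_pos u).ne'),
    ← Complex.ofReal_log (Real.exp_pos u).le, Real.log_exp, planeWave]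
  ring_nf

theorem integral_gumbelKernel_mul_planeWave {r : ℂ} (hr : 0 < r.re) (p : ℝ) :
    ∫ u, gumbelKernel r u * planeWave p u =
      -r * ((1 / r) ^ (1 - Complex.I * p) * Complex.Gamma (1 - Complex.I * p)) := by
  have h := integral_cpow_mul_cexp_neg_mul_Ioi (a := 1 - Complex.I * p) (z := r) (by simp) hr
  rw [← h, ← integral_const_mul, ← integral_exp_smul_comp_exp]
  congr 1
  ext u
  rw [gumbelKernel, planeWave_eq_cpow]
  ring_nf

/-- The average of `gumbelKernel r` over multiplicative Gamma-distributed rescalings. -/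
noncomputable def gammaKernel (n : ℕ) (r : ℂ) (u : ℝ) : ℂ :=
  -r * (Real.exp u : ℝ) * ((1 + r * (Real.exp u : ℝ) / n) ^ (n + 1))⁻¹

open ProbabilityTheory in
theorem pushConv_gumbelKernel {n : ℕ} (hn : n ≠ 0) {r : ℂ} (hr : 0 ≤ r.re) (τ : ℝ) :
    pushConv (gammaMeasure n n) (fun _ => 1) (fun v => -Real.log v) (gumbelKernel r) τ =
      gammaKernel n r τ := by
  have h := integral_mul_cexp_gammaMeasure hn (z := r * (Real.exp τ : ℝ))
    (by rw [Complex.re_mul_ofReal]; positivity)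
  rw [gammaKernel, ← h, pushConv, ← integral_const_mul]
  refine integral_congr_ae ?_
  filter_upwards [ae_pos_gammaMeasure n n] with v hv
  rw [gumbelKernel, sub_neg_eq_add, Real.exp_add, Real.exp_log hv]
  push_cast
  ring_nf

theorem one_add_sq_le_norm_pow {n : ℕ} (hn : n ≠ 0) {r : ℂ} (hr : 0 ≤ r.re) (hi : r.im = 1)
    {w : ℝ} (hw : 0 ≤ w) : 1 + (w / n) ^ 2 ≤ ‖(1 + r * w / n) ^ (n + 1)‖ := by
  have hre : (1 + r * w / n : ℂ).re = 1 + r.re * w / n := by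
    rw [← Complex.ofReal_natCast, Complex.add_re, Complex.div_ofReal_re, Complex.re_mul_ofReal,
      Complex.one_re]
  have him : (1 + r * w / n : ℂ).im = w / n := by
    rw [← Complex.ofReal_natCast, Complex.add_im, Complex.div_ofReal_im, Complex.im_mul_ofReal,
      Complex.one_im, hi, one_mul, zero_add]
  have h1 : 1 + (w / n) ^ 2 ≤ ‖(1 + r * w / n : ℂ)‖ ^ 2 := by
    rw [← Complex.normSq_eq_norm_sq, Complex.normSq_apply, hre, him]
    have : 0 ≤ r.re * w / n := by positivity
    nlinarith
  have h2 : 1 ≤ ‖(1 + r * w / n : ℂ)‖ := by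
    nlinarith [sq_nonneg (w / n), norm_nonneg (1 + r * w / n : ℂ)]
  rw [norm_pow]
  exact h1.trans (pow_le_pow_right₀ h2 (by omega))

theorem norm_gammaKernel_le {n : ℕ} (hn : n ≠ 0) {r : ℂ} (hr : 0 ≤ r.re) (hi : r.im = 1)
    (hr2 : ‖r‖ ≤ 2) (u : ℝ) :
    ‖gammaKernel n r u‖ ≤ Real.exp u * (2 * (1 + (Real.exp u / n) ^ 2)⁻¹) := by
  have h := one_add_sq_le_norm_pow hn hr hi (Real.exp_pos u).le
  have h0 : 0 < 1 + (Real.exp u / n) ^ 2 := by positivity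
  rw [gammaKernel, norm_mul, norm_mul, norm_neg, norm_inv, Complex.norm_real,
    Real.norm_of_nonneg (Real.exp_pos u).le]
  have h1 := inv_anti₀ h0 h
  calc _ ≤ 2 * Real.exp u * (1 + (Real.exp u / n) ^ 2)⁻¹ := by gcongr
    _ = _ := by ring

theorem integrable_exp_mul_inv_one_add_sq {n : ℕ} (hn : n ≠ 0) :
    Integrable fun u : ℝ => Real.exp u * (2 * (1 + (Real.exp u / n) ^ 2)⁻¹) := by
  have hn0 : (n : ℝ) ≠ 0 := by exact_mod_cast hn
  have h : Integrable fun v : ℝ => ((2 * (1 + (v / n) ^ 2)⁻¹ : ℝ) : ℂ) :=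
    ((integrable_inv_one_add_sq.comp_div hn0).const_mul 2).ofReal
  have h2 := (integrable_exp_smul_comp_exp h.integrableOn).re
  refine h2.congr (ae_of_all _ fun u => ?_)
  simp only [← Complex.ofReal_mul, RCLike.re_to_complex, Complex.ofReal_re]

theorem measurable_gammaKernel (n : ℕ) (r : ℂ) : Measurable (gammaKernel n r) := by
  unfold gammaKernel
  fun_prop

theorem integrable_gammaKernel {n : ℕ} (hn : n ≠ 0) {r : ℂ} (hr : 0 ≤ r.re) (hi : r.im = 1)
    (hr2 : ‖r‖ ≤ 2) : Integrable (gammaKernel n r) :=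
  (integrable_exp_mul_inv_one_add_sq hn).mono' (measurable_gammaKernel n r).aestronglyMeasurable
    (ae_of_all _ (norm_gammaKernel_le hn hr hi hr2))

/-- The Mellin transform of the Gamma distribution along the imaginary axis. -/
noncomputable def gammaChar (n : ℕ) (p : ℝ) : ℂ :=
  ∫ v, 1 * planeWave p (-Real.log v) ∂ProbabilityTheory.gammaMeasure n n

/-- The Fourier transform of the derivative of `u ↦ exp (-i e^u)`, in the sense of Abel summation. -/
noncomputable def gumbelChar (p : ℝ) : ℂ :=
  -Complex.I * ((1 / Complex.I) ^ (1 - Complex.I * p) * Complex.Gamma (1 - Complex.I * p))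

open ProbabilityTheory in
theorem integral_gammaKernel_mul_planeWave_of_re_pos {n : ℕ} (hn : n ≠ 0) {r : ℂ}
    (hr : 0 < r.re) (p : ℝ) : ∫ u, gammaKernel n r u * planeWave p u =
      gammaChar n p *
        (-r * ((1 / r) ^ (1 - Complex.I * p) * Complex.Gamma (1 - Complex.I * p))) := by
  have hn0 : (0 : ℝ) < n := by positivity
  have := isProbabilityMeasure_gammaMeasure hn0 hn0
  rw [← integral_gumbelKernel_mul_planeWave hr, gammaChar,
    ← integral_pushConv_mul_planeWave (integrable_const _) (by fun_prop)
      (measurable_gumbelKernel r) (integrable_gumbelKernel hr)]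
  simp_rw [pushConv_gumbelKernel hn hr.le]

theorem integral_gammaKernel_mul_planeWave {n : ℕ} (hn : n ≠ 0) (p : ℝ) :
    ∫ u, gammaKernel n Complex.I u * planeWave p u = gammaChar n p * gumbelChar p := by
  let r : ℕ → ℂ := fun k => Complex.I + ((1 / ((k : ℝ) + 1) : ℝ) : ℂ)
  have hr : Tendsto r atTop (nhds Complex.I) := by
    have h := (Complex.continuous_ofReal.tendsto 0).comp
      (tendsto_one_div_add_atTop_nhds_zero_nat (𝕜 := ℝ))
    simpa [r, Function.comp_def] using h.const_add Complex.I
  have hre (k : ℕ) : 0 < (r k).re := by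
    rw [Complex.add_re, Complex.I_re, Complex.ofReal_re]; positivity
  have him (k : ℕ) : (r k).im = 1 := by
    rw [Complex.add_im, Complex.I_im, Complex.ofReal_im, add_zero]
  have hr2 (k : ℕ) : ‖r k‖ ≤ 2 := by
    refine (norm_add_le _ _).trans ?_
    rw [Complex.norm_I, Complex.norm_real, Real.norm_of_nonneg (by positivity)]
    have : 1 / ((k : ℝ) + 1) ≤ 1 := by
      rw [div_le_one (by positivity)]
      linarith [(Nat.cast_nonneg k : (0 : ℝ) ≤ k)]
    linarith
  have h1 : Tendsto (fun k => ∫ u, gammaKernel n (r k) u * planeWave p u) atTop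
      (nhds (∫ u, gammaKernel n Complex.I u * planeWave p u)) := by
    refine tendsto_integral_of_dominated_convergence _ (fun k => ?_)
      (integrable_exp_mul_inv_one_add_sq hn) (fun k => ae_of_all _ fun u => ?_)
      (ae_of_all _ fun u => ?_)
    · have := measurable_gammaKernel n (r k)
      exact Measurable.aestronglyMeasurable (by fun_prop)
    · rw [norm_mul, norm_planeWave, mul_one]
      exact norm_gammaKernel_le hn (hre k).le (him k) (hr2 k) u
    · refine Tendsto.mul_const _ ?_
      unfold gammaKernel
      refine ((hr.neg.mul_const _).mul (Tendsto.inv₀ ?_ ?_))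
      · exact ((((hr.mul_const _).div_const _).const_add _).pow _)
      · intro h0
        have h := one_add_sq_le_norm_pow hn (r := Complex.I) (by simp) (by simp)
          (Real.exp_pos u).le
        rw [h0, norm_zero] at h
        nlinarith [sq_nonneg (Real.exp u / n)]
  have h2 : Tendsto (fun k => ∫ u, gammaKernel n (r k) u * planeWave p u) atTop
      (nhds (gammaChar n p * gumbelChar p)) := by
    simp_rw [fun k => integral_gammaKernel_mul_planeWave_of_re_pos hn (hre k) p]
    refine Tendsto.const_mul _ (hr.neg.mul (Tendsto.mul_const _ ?_))
    refine Tendsto.cpow (hr.inv₀ Complex.I_ne_zero |>.const_mul 1 |>.congr fun k =>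
      (div_eq_mul_inv _ _).symm) tendsto_const_nhds ?_
    simp [Complex.slitPlane]
  exact tendsto_nhds_unique h1 h2

open ProbabilityTheory in
theorem norm_gammaChar_le {n : ℕ} (hn : n ≠ 0) (p : ℝ) : ‖gammaChar n p‖ ≤ 1 := by
  have hn0 : (0 : ℝ) < n := by positivity
  have := isProbabilityMeasure_gammaMeasure hn0 hn0
  refine (norm_integral_le_of_norm_le_const (C := 1) (ae_of_all _ fun v => ?_)).trans ?_
  · rw [one_mul, norm_planeWave]
  · simp

open ProbabilityTheory in
theorem gammaChar_eq {n : ℕ} (hn : n ≠ 0) (p : ℝ) :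
    gammaChar n p = (n : ℂ) ^ (n : ℂ) / Complex.Gamma n *
      ((1 / (n : ℂ)) ^ ((n : ℂ) + Complex.I * p) * Complex.Gamma (n + Complex.I * p)) := by
  have hn0 : (0 : ℝ) < n := by positivity
  have h := integral_cpow_mul_cexp_gammaMeasure (s := Complex.I * p) (z := 0) hn0
    (by simpa using hn0) (by simpa using hn0)
  simp only [zero_mul, neg_zero, Complex.exp_zero, mul_one, add_zero,
    Complex.ofReal_natCast] at h
  rw [← h, gammaChar]
  refine integral_congr_ae ?_
  filter_upwards [ae_pos_gammaMeasure n n] with v hv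
  rw [one_mul, planeWave, Complex.cpow_def_of_ne_zero (by exact_mod_cast hv.ne'),
    ← Complex.ofReal_log hv.le]
  push_cast
  ring_nf

theorem Gamma_add_natCast {s : ℂ} (hs : ∀ m : ℕ, s + m ≠ 0) (n : ℕ) :
    Complex.Gamma (s + n) = Complex.Gamma s * ∏ j ∈ Finset.range n, (s + j) := by
  induction n with
  | zero => simp
  | succ n ih =>
    rw [Finset.prod_range_succ, Nat.cast_succ, ← add_assoc, Complex.Gamma_add_one _ (hs n), ih]
    ring

theorem gammaChar_eq_div_GammaSeq {n : ℕ} (hn : n ≠ 0) {p : ℝ} (hp : p ≠ 0) :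
    gammaChar n p = Complex.Gamma (Complex.I * p) / Complex.GammaSeq (Complex.I * p) n *
      (1 + Complex.I * p / n)⁻¹ := by
  set s : ℂ := Complex.I * p with hs
  have hn0 : (n : ℂ) ≠ 0 := by exact_mod_cast hn
  have hsm (m : ℕ) : s + m ≠ 0 := by
    intro h
    have := congrArg Complex.im h
    simp [hs, hp] at this
  have hfac : Complex.Gamma n * n = n.factorial := by
    rw [← Complex.Gamma_nat_eq_factorial, Complex.Gamma_add_one _ hn0, mul_comm]
  have hG : Complex.Gamma n ≠ 0 := by
    intro h
    rw [h, zero_mul] at hfac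
    exact (Nat.factorial_ne_zero n) (by exact_mod_cast hfac.symm)
  have hpow : (n : ℂ) ^ (n : ℂ) * (1 / (n : ℂ)) ^ ((n : ℂ) + s) = ((n : ℂ) ^ s)⁻¹ := by
    have h1 : (1 / (n : ℂ)) ^ ((n : ℂ) + s) = ((n : ℂ) ^ ((n : ℂ) + s))⁻¹ := by
      rw [one_div, Complex.inv_cpow _ _ (by simp [Complex.natCast_arg, Real.pi_ne_zero.symm])]
    have h2 : (n : ℂ) ^ (n : ℂ) ≠ 0 := by simp [hn0]
    rw [h1, Complex.cpow_add _ _ hn0]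
    field_simp
  have hns : (n : ℂ) ^ s ≠ 0 := by simp [Complex.cpow_eq_zero_iff, hn0]
  have hprod : ∏ j ∈ Finset.range n, (s + j) ≠ 0 := Finset.prod_ne_zero_iff.2 fun j _ => hsm j
  have hsn := hsm n
  have h3 : 1 + s / n = (s + n) / n := by field_simp; ring
  rw [gammaChar_eq hn, ← hs, add_comm (n : ℂ) s, Gamma_add_natCast hsm, Complex.GammaSeq,
    Finset.prod_range_succ, ← hfac, h3]
  rw [add_comm (n : ℂ) s] at hpow
  calc _ = ((n : ℂ) ^ (n : ℂ) * (1 / (n : ℂ)) ^ (s + n)) * (Complex.Gamma s *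
      ∏ j ∈ Finset.range n, (s + j)) / Complex.Gamma n := by ring
    _ = _ := by
      rw [hpow]
      field_simp

theorem tendsto_gammaChar {p : ℝ} (hp : p ≠ 0) :
    Tendsto (fun n => gammaChar n p) atTop (nhds 1) := by
  have hG : Complex.Gamma (Complex.I * p) ≠ 0 := by
    refine Complex.Gamma_ne_zero fun m h => ?_
    have := congrArg Complex.im h
    simp [hp] at this
  have h1 := (tendsto_const_nhds (x := Complex.Gamma (Complex.I * p))).div
    (Complex.GammaSeq_tendsto_Gamma (Complex.I * p)) hG
  have h2 : Tendsto (fun n : ℕ => (1 + Complex.I * p / (n : ℂ))⁻¹) atTop (nhds 1) := by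
    have h := (tendsto_const_div_atTop_nhds_zero_nat (Complex.I * p)).const_add 1
    have h' := h.inv₀ (by simp)
    simpa using h'
  have h3 := h1.mul h2
  rw [div_self hG, one_mul] at h3
  refine h3.congr' ?_
  filter_upwards [eventually_ne_atTop 0] with n hn
  exact (gammaChar_eq_div_GammaSeq hn hp).symm

theorem norm_gumbelChar_sq {p : ℝ} (hp : p ≠ 0) :
    ‖gumbelChar p * (Complex.I * p)⁻¹‖ ^ 2 =
      2 * Real.pi / (p * (Real.exp (2 * Real.pi * p) - 1)) := by
  have hsinh : Real.sinh (Real.pi * p) ≠ 0 := by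
    rw [Ne, Real.sinh_eq_zero]; exact mul_ne_zero Real.pi_ne_zero hp
  have hG : ‖Complex.Gamma (1 - Complex.I * p)‖ ^ 2 =
      Real.pi * p / Real.sinh (Real.pi * p) := by
    have h1 : (starRingEnd ℂ) (1 - Complex.I * p) = Complex.I * p + 1 := by
      simp; ring
    have hip : Complex.I * p ≠ 0 := mul_ne_zero Complex.I_ne_zero (by exact_mod_cast hp)
    have h2 : ((‖Complex.Gamma (1 - Complex.I * p)‖ ^ 2 : ℝ) : ℂ) =
        ((Real.pi * p / Real.sinh (Real.pi * p) : ℝ) : ℂ) := by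
      push_cast
      rw [← Complex.mul_conj', ← Complex.Gamma_conj, h1, Complex.Gamma_add_one _ hip,
        show Complex.Gamma (1 - Complex.I * p) * (Complex.I * p * Complex.Gamma (Complex.I * p)) =
          Complex.I * p * (Complex.Gamma (Complex.I * p) * Complex.Gamma (1 - Complex.I * p))
          by ring, Complex.Gamma_mul_Gamma_one_sub,
        show (Real.pi : ℂ) * (Complex.I * p) = (Real.pi * p) * Complex.I by ring,
        Complex.sin_mul_I]
      have : Complex.sinh (Real.pi * p) ≠ 0 := by exact_mod_cast hsinh
      field_simp
    exact_mod_cast h2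
  have hc : ‖(1 / Complex.I) ^ (1 - Complex.I * p)‖ ^ 2 = Real.exp (-(Real.pi * p)) := by
    rw [show 1 / Complex.I = -Complex.I by simp,
      Complex.norm_cpow_of_ne_zero (by simp), Complex.arg_neg_I]
    simp [← Real.exp_nat_mul, ← Real.exp_neg]
    ring_nf
  rw [gumbelChar, norm_mul, norm_mul, norm_mul, norm_neg, norm_inv, norm_mul, Complex.norm_I,
    mul_pow, mul_pow, mul_pow, hG, hc, Complex.norm_real, one_mul, inv_pow, Real.norm_eq_abs,
    sq_abs, one_pow, one_mul]
  have he : Real.exp (2 * Real.pi * p) - 1 =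
      2 * Real.sinh (Real.pi * p) / Real.exp (-(Real.pi * p)) := by
    rw [Real.sinh_eq, eq_div_iff (Real.exp_pos _).ne', sub_mul, ← Real.exp_add]
    ring_nf
  rw [he]
  have := (Real.exp_pos (-(Real.pi * p))).ne'
  field_simp

theorem sq_lintegral_enorm_le {Ω : Type*} [MeasurableSpace Ω] {μ : Measure Ω}
    [IsProbabilityMeasure μ] {F : Ω → ℂ} (hF : AEStronglyMeasurable F μ) :
    (∫⁻ v, ‖F v‖ₑ ∂μ) ^ 2 ≤ ∫⁻ v, ‖F v‖ₑ ^ 2 ∂μ := by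
  have h := ENNReal.lintegral_mul_le_Lp_mul_Lq μ Real.HolderConjugate.two_two hF.enorm
    (aemeasurable_const (b := 1))
  simp only [Pi.mul_apply, mul_one, ENNReal.one_rpow, lintegral_const, measure_univ] at h
  calc _ ≤ ((∫⁻ v, ‖F v‖ₑ ^ (2 : ℝ) ∂μ) ^ (1 / 2 : ℝ)) ^ 2 := by gcongr
    _ = _ := by
      rw [← ENNReal.rpow_natCast, ← ENNReal.rpow_mul]
      norm_num

/-- The wave `u ↦ exp (-i e^u)`. -/
noncomputable def gumbelWave (u : ℝ) : ℂ := Complex.exp (-(Complex.I * (Real.exp u : ℝ)))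

theorem continuous_gumbelWave : Continuous gumbelWave := by
  unfold gumbelWave
  fun_prop

theorem norm_gumbelWave (u : ℝ) : ‖gumbelWave u‖ = 1 := by
  rw [gumbelWave, Complex.norm_exp]
  simp [-Complex.ofReal_exp]

/-- The average of `gumbelWave` over Gamma-distributed rescalings. -/
noncomputable def gammaWave (n : ℕ) (u : ℝ) : ℂ :=
  ((1 + Complex.I * (Real.exp u : ℝ) / n) ^ n)⁻¹

open ProbabilityTheory in
theorem gammaWave_eq_integral {n : ℕ} (hn : n ≠ 0) (u : ℝ) :
    gammaWave n u = ∫ v, gumbelWave (u + Real.log v) ∂gammaMeasure n n := by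
  rw [gammaWave, ← integral_cexp_gammaMeasure hn (by simp [-Complex.ofReal_exp])]
  refine integral_congr_ae ?_
  filter_upwards [ae_pos_gammaMeasure n n] with v hv
  rw [gumbelWave, Real.exp_add, Real.exp_log hv]
  push_cast
  ring_nf

open ProbabilityTheory in
theorem norm_gammaWave_le {n : ℕ} (hn : n ≠ 0) (u : ℝ) : ‖gammaWave n u‖ ≤ 1 := by
  have hn0 : (0 : ℝ) < n := by positivity
  have := isProbabilityMeasure_gammaMeasure hn0 hn0
  rw [gammaWave_eq_integral hn]
  refine (norm_integral_le_of_norm_le_const (C := 1)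
    (ae_of_all _ fun v => (norm_gumbelWave _).le)).trans ?_
  simp

theorem one_add_I_mul_exp_div_ne_zero {n : ℕ} (hn : n ≠ 0) (u : ℝ) :
    1 + Complex.I * (Real.exp u : ℝ) / n ≠ 0 := by
  intro h0
  have h := one_add_sq_le_norm_pow hn (r := Complex.I) (by simp) (by simp) (Real.exp_pos u).le
  rw [h0, zero_pow (by omega), norm_zero] at h
  nlinarith [sq_nonneg (Real.exp u / n)]

theorem hasDerivAt_gammaWave {n : ℕ} (hn : n ≠ 0) (u : ℝ) :
    HasDerivAt (gammaWave n) (gammaKernel n Complex.I u) u := by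
  have h0 := one_add_I_mul_exp_div_ne_zero hn u
  have hn0 : (n : ℂ) ≠ 0 := by exact_mod_cast hn
  have h1 : HasDerivAt (fun u : ℝ => 1 + Complex.I * (Real.exp u : ℝ) / n)
      (Complex.I * (Real.exp u : ℝ) / n) u :=
    (((Real.hasDerivAt_exp u).ofReal_comp.const_mul Complex.I).div_const _).const_add 1
  refine HasDerivAt.congr_deriv (f := gammaWave n) ((h1.pow n).inv (pow_ne_zero _ h0)) ?_
  obtain ⟨m, rfl⟩ := Nat.exists_eq_succ_of_ne_zero hn
  rw [gammaKernel]
  simp only [Nat.succ_eq_add_one, Nat.add_sub_cancel, Pi.pow_apply] at *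
  set z := 1 + Complex.I * (Real.exp u : ℝ) / ((m + 1 : ℕ) : ℂ)
  field_simp
  ring

theorem tendsto_gammaWave_atBot (n : ℕ) : Tendsto (gammaWave n) atBot (nhds 1) := by
  have h : Tendsto (fun u => (Real.exp u : ℂ)) atBot (nhds 0) := by
    simpa only [Complex.ofReal_zero, Function.comp_def] using
      (Complex.continuous_ofReal.tendsto 0).comp Real.tendsto_exp_atBot
  have h2 := ((((h.const_mul Complex.I).div_const (n : ℂ)).const_add 1).pow n).inv₀ (by simp)
  simp only [mul_zero, zero_div, add_zero, one_pow, inv_one] at h2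
  exact h2

theorem setIntegral_Iic_gammaKernel {n : ℕ} (hn : n ≠ 0) (t : ℝ) :
    ∫ u in Iic t, gammaKernel n Complex.I u = gammaWave n t - 1 :=
  integral_Iic_of_hasDerivAt_of_tendsto' (fun u _ => hasDerivAt_gammaWave hn u)
    (integrable_gammaKernel hn (by simp) (by simp) (by simp)).integrableOn
    (tendsto_gammaWave_atBot n)

theorem tendsto_gammaWave (u : ℝ) :
    Tendsto (fun n => gammaWave n u) atTop (nhds (gumbelWave u)) := by
  have h := (Complex.tendsto_one_add_div_pow_exp (Complex.I * (Real.exp u : ℝ))).inv₀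
    (Complex.exp_ne_zero _)
  rwa [← Complex.exp_neg] at h

theorem measurable_gammaWave (n : ℕ) : Measurable (gammaWave n) := by
  unfold gammaWave
  fun_prop

section

variable {g : ℝ → ℂ} {x : ℝ → ℝ}

theorem aestronglyMeasurable_mul_comp_sub {K : ℝ → ℂ} (hg : Integrable g) (hx : Measurable x)
    (hK : Measurable K) (τ : ℝ) : AEStronglyMeasurable fun y => g y * K (τ - x y) :=
  hg.aestronglyMeasurable.mul (Measurable.aestronglyMeasurable (by fun_prop))

theorem pushConv_gammaWave (hg : Integrable g) (hg0 : ∫ y, g y = 0) (hx : Measurable x) {n : ℕ}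
    (hn : n ≠ 0) (τ : ℝ) : pushConv volume g x (gammaWave n) τ =
      pushConv volume (pushConv volume g x (gammaKernel n Complex.I)) (fun y => y)
        (expKernel 0) τ := by
  have hK := integrable_gammaKernel hn (r := Complex.I) (by simp) (by simp) (by simp)
  have h1 : pushConv volume (pushConv volume g x (gammaKernel n Complex.I)) (fun y => y)
      (expKernel 0) τ = ∫ σ in Iic τ, pushConv volume g x (gammaKernel n Complex.I) σ := by
    conv_lhs => rw [pushConv]
    rw [← integral_indicator measurableSet_Iic]
    congr 1
    ext σ
    by_cases hσ : σ ≤ τ <;> simp [expKernel, hσ]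
  rw [h1, setIntegral_Iic_pushConv hg hx (measurable_gammaKernel _ _) hK]
  simp_rw [setIntegral_Iic_gammaKernel hn, mul_sub, mul_one]
  rw [integral_sub, hg0, sub_zero, pushConv]
  · exact hg.mul_bdd (c := 1) (Measurable.aestronglyMeasurable
      ((measurable_gammaWave n).comp (by fun_prop))) (ae_of_all _ fun y => norm_gammaWave_le hn _)
  · exact hg

theorem lintegral_enorm_pushConv_gammaWave_sq (hg : Integrable g) (hg0 : ∫ y, g y = 0)
    (hx : Measurable x) {n : ℕ} (hn : n ≠ 0) :
    ENNReal.ofReal (2 * Real.pi) * ∫⁻ τ, ‖pushConv volume g x (gammaWave n) τ‖ₑ ^ 2 =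
      ∫⁻ p : ℝ, ‖gammaChar n p * ((∫ y, g y * planeWave p (x y)) *
        (gumbelChar p * (Complex.I * p)⁻¹))‖ₑ ^ 2 := by
  have hK := integrable_gammaKernel hn (r := Complex.I) (by simp) (by simp) (by simp)
  simp_rw [pushConv_gammaWave hg hg0 hx hn]
  rw [lintegral_enorm_pushConv_heaviside_sq
    (integrable_pushConv hg hx (measurable_gammaKernel _ _) hK) measurable_id'
    Function.injective_id]
  congr 1
  ext p
  rw [integral_pushConv_mul_planeWave hg hx (measurable_gammaKernel _ _) hK,
    integral_gammaKernel_mul_planeWave hn]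
  ring_nf

open ProbabilityTheory in
theorem lintegral_enorm_pushConv_gammaWave_sq_le (hg : Integrable g)
    (hx : Measurable x) {n : ℕ} (hn : n ≠ 0) :
    ∫⁻ τ, ‖pushConv volume g x (gammaWave n) τ‖ₑ ^ 2 ≤
      ∫⁻ τ, ‖pushConv volume g x gumbelWave τ‖ₑ ^ 2 := by
  have hn0 : (0 : ℝ) < n := by positivity
  have := isProbabilityMeasure_gammaMeasure hn0 hn0
  have hE := continuous_gumbelWave.measurable
  have hW : Continuous (pushConv volume g x gumbelWave) := by
    refine continuous_of_dominated (bound := fun y => ‖g y‖)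
      (fun τ => aestronglyMeasurable_mul_comp_sub hg hx hE τ)
      (fun τ => ae_of_all _ fun y => ?_) hg.norm (ae_of_all _ fun y => ?_)
    · rw [norm_mul, norm_gumbelWave, mul_one]
    · exact continuous_const.mul (continuous_gumbelWave.comp (by fun_prop))
  have hrep (τ : ℝ) : pushConv volume g x (gammaWave n) τ =
      ∫ v, pushConv volume g x gumbelWave (τ + Real.log v) ∂gammaMeasure n n := by
    have hi : Integrable (fun q : ℝ × ℝ => g q.1 * gumbelWave (τ - x q.1 + Real.log q.2))
        (volume.prod (gammaMeasure n n)) := by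
      refine (hg.comp_fst _).mul_bdd (c := 1) (Measurable.aestronglyMeasurable (by fun_prop))
        (ae_of_all _ fun q => (norm_gumbelWave _).le)
    simp_rw [pushConv, gammaWave_eq_integral hn, ← integral_const_mul]
    rw [integral_integral_swap hi]
    simp_rw [sub_add_eq_add_sub]
  calc _ ≤ ∫⁻ τ, ∫⁻ v, ‖pushConv volume g x gumbelWave (τ + Real.log v)‖ₑ ^ 2
        ∂gammaMeasure n n := by
        refine lintegral_mono fun τ => ?_
        rw [hrep]
        refine le_trans ?_ (sq_lintegral_enorm_le (Measurable.aestronglyMeasurable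
          (hW.measurable.comp (by fun_prop))))
        gcongr
        exact enorm_integral_le_lintegral_enorm _
    _ = ∫⁻ v, (∫⁻ τ, ‖pushConv volume g x gumbelWave (τ + Real.log v)‖ₑ ^ 2)
        ∂gammaMeasure n n := by
        refine lintegral_lintegral_swap (Measurable.aemeasurable ?_)
        exact (hW.measurable.comp (by fun_prop)).enorm.pow_const 2
    _ = _ := by
        simp_rw [lintegral_add_right_eq_self
          (fun τ => ‖pushConv volume g x gumbelWave τ‖ₑ ^ 2)]
        simp

theorem continuous_gumbelChar : Continuous gumbelChar := by
  have h : Continuous fun p : ℝ => Complex.Gamma (1 - Complex.I * p) := by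
    refine continuous_iff_continuousAt.2 fun p => ?_
    refine ContinuousAt.comp (f := fun p : ℝ => 1 - Complex.I * (p : ℂ))
      (Complex.differentiableAt_Gamma _ fun m h => ?_).continuousAt (by fun_prop)
    have := congrArg Complex.re h
    simp at this
    linarith [(Nat.cast_nonneg m : (0 : ℝ) ≤ m)]
  refine continuous_const.mul (Continuous.mul ?_ h)
  exact Continuous.const_cpow (by fun_prop) (Or.inl (by simp))

open ProbabilityTheory in
theorem continuous_gammaChar {n : ℕ} (hn : n ≠ 0) : Continuous (gammaChar n) := by
  have hn0 : (0 : ℝ) < n := by positivity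
  have := isProbabilityMeasure_gammaMeasure hn0 hn0
  exact continuous_integral_mul_planeWave (integrable_const _) (by fun_prop)

theorem lintegral_enorm_pushConv_gumbelWave_sq (hg : Integrable g) (hg0 : ∫ y, g y = 0)
    (hx : Measurable x) :
    ENNReal.ofReal (2 * Real.pi) * ∫⁻ τ, ‖pushConv volume g x gumbelWave τ‖ₑ ^ 2 =
      ∫⁻ p : ℝ, ‖(∫ y, g y * planeWave p (x y)) * (gumbelChar p * (Complex.I * p)⁻¹)‖ₑ ^ 2 := by
  have h1 : Tendsto (fun n : ℕ => ∫⁻ τ, ‖pushConv volume g x (gammaWave (n + 1)) τ‖ₑ ^ 2)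
      atTop (nhds (∫⁻ τ, ‖pushConv volume g x gumbelWave τ‖ₑ ^ 2)) := by
    refine tendsto_lintegral_enorm_sq (fun n => ?_)
      (fun n => lintegral_enorm_pushConv_gammaWave_sq_le hg hx n.succ_ne_zero)
      (ae_of_all _ fun τ => ?_)
    · refine Continuous.aestronglyMeasurable (continuous_of_dominated (bound := fun y => ‖g y‖)
        (fun τ => aestronglyMeasurable_mul_comp_sub hg hx (measurable_gammaWave _) τ)
        (fun τ => ae_of_all _ fun y => ?_) hg.norm (ae_of_all _ fun y => ?_))
      · rw [norm_mul]
        exact mul_le_of_le_one_right (norm_nonneg _) (norm_gammaWave_le n.succ_ne_zero _)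
      · have : Continuous (gammaWave (n + 1)) := continuous_iff_continuousAt.2 fun u =>
          (hasDerivAt_gammaWave n.succ_ne_zero u).continuousAt
        exact continuous_const.mul (this.comp (by fun_prop))
    · refine tendsto_integral_of_dominated_convergence (fun y => ‖g y‖)
        (fun n => aestronglyMeasurable_mul_comp_sub hg hx (measurable_gammaWave _) τ) hg.norm
        (fun n => ae_of_all _ fun y => ?_) (ae_of_all _ fun y => ?_)
      · rw [norm_mul]
        exact mul_le_of_le_one_right (norm_nonneg _) (norm_gammaWave_le n.succ_ne_zero _)
      · exact ((tendsto_gammaWave _).comp (tendsto_add_atTop_nat 1)).const_mul _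
  have h2 : Tendsto (fun n : ℕ => ∫⁻ p : ℝ, ‖gammaChar (n + 1) p *
      ((∫ y, g y * planeWave p (x y)) * (gumbelChar p * (Complex.I * p)⁻¹))‖ₑ ^ 2) atTop
      (nhds (∫⁻ p : ℝ, ‖(∫ y, g y * planeWave p (x y)) *
        (gumbelChar p * (Complex.I * p)⁻¹)‖ₑ ^ 2)) := by
    refine tendsto_lintegral_enorm_sq (fun n => ?_) (fun n => lintegral_mono fun p => ?_) ?_
    · have h1 := (continuous_gammaChar n.succ_ne_zero).measurable
      have h2 := (continuous_integral_mul_planeWave hg hx).measurable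
      have h3 := continuous_gumbelChar.measurable
      exact Measurable.aestronglyMeasurable (by fun_prop)
    · rw [enorm_mul]
      gcongr
      refine mul_le_of_le_one_left' ?_
      rw [← ofReal_norm, ENNReal.ofReal_le_one]
      exact norm_gammaChar_le n.succ_ne_zero p
    · filter_upwards [Measure.ae_ne volume 0] with p hp
      simpa using ((tendsto_gammaChar hp).comp (tendsto_add_atTop_nat 1)).mul_const
        ((∫ y, g y * planeWave p (x y)) * (gumbelChar p * (Complex.I * p)⁻¹))
  refine tendsto_nhds_unique (ENNReal.Tendsto.const_mul h1 (Or.inr ENNReal.ofReal_ne_top)) ?_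
  simp_rw [lintegral_enorm_pushConv_gammaWave_sq hg hg0 hx (Nat.succ_ne_zero _)]
  exact h2

end

theorem Fk_eq (x : ℝ → ℝ) (g : ℝ → ℂ) (p : ℝ) :
    Fk x g p = (Real.sqrt (2 * Real.pi) : ℂ)⁻¹ * ∫ y, g y * planeWave p (x y) := rfl

theorem ft_eq_Fk (g : ℝ → ℂ) (p : ℝ) : ft g p = Fk (fun y => y) g p := rfl

theorem norm_Fk_sq (x : ℝ → ℝ) (g : ℝ → ℂ) (p : ℝ) :
    ‖Fk x g p‖ ^ 2 = (2 * Real.pi)⁻¹ * ‖∫ y, g y * planeWave p (x y)‖ ^ 2 := by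
  rw [Fk_eq, norm_mul, norm_inv, Complex.norm_real, Real.norm_of_nonneg (Real.sqrt_nonneg _),
    mul_pow, inv_pow, Real.sq_sqrt (by positivity)]

theorem ofReal_norm_sq (z : ℂ) : ENNReal.ofReal (‖z‖ ^ 2) = ‖z‖ₑ ^ 2 := by
  rw [ENNReal.ofReal_pow (norm_nonneg _), ofReal_norm]

theorem continuous_Fk {x : ℝ → ℝ} {g : ℝ → ℂ} (hg : Integrable g) (hx : Measurable x) :
    Continuous (Fk x g) :=
  continuous_const.mul (continuous_integral_mul_planeWave hg hx)

/-- Integrating the Planck-weighted intensity over all frequencies gives the `L²` norm of the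
signal in the exponential coordinate. -/
theorem lintegral_norm_Fk_sq_div {x : ℝ → ℝ} {g : ℝ → ℂ} (hg : Integrable g)
    (hg0 : ∫ y, g y = 0) (hx : Measurable x) :
    ∫⁻ p, ENNReal.ofReal (‖Fk x g p‖ ^ 2 / (2 * p * (Real.exp (2 * Real.pi * p) - 1))) =
      ENNReal.ofReal (4 * Real.pi)⁻¹ * ∫⁻ τ, ‖pushConv volume g x gumbelWave τ‖ₑ ^ 2 := by
  have h := lintegral_enorm_pushConv_gumbelWave_sq hg hg0 hx
  have h2 : ENNReal.ofReal (4 * Real.pi)⁻¹ =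
      ENNReal.ofReal (8 * Real.pi ^ 2)⁻¹ * ENNReal.ofReal (2 * Real.pi) := by
    rw [← ENNReal.ofReal_mul (by positivity)]
    congr 1
    field_simp
    norm_num
  rw [h2, mul_assoc, h, ← lintegral_const_mul' _ _ ENNReal.ofReal_ne_top]
  refine lintegral_congr_ae ?_
  filter_upwards [Measure.ae_ne volume 0] with p hp
  rw [enorm_mul, mul_pow, ← ofReal_norm_sq, ← ofReal_norm_sq (gumbelChar p * _),
    norm_gumbelChar_sq hp, norm_Fk_sq, ← ENNReal.ofReal_mul (by positivity),
    ← ENNReal.ofReal_mul (by positivity)]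
  congr 1
  have h3 : Real.exp (2 * Real.pi * p) - 1 ≠ 0 := by
    rw [sub_ne_zero, Ne, Real.exp_eq_one_iff]
    positivity
  field_simp
  ring

theorem exp_neg_xC (y : ℝ) : Real.exp (-xC y) = 1 + Real.exp (-y) := by
  rw [xC, neg_neg, Real.exp_log (by positivity)]

theorem measurable_xC : Measurable xC := by
  unfold xC
  fun_prop

/-- The exponentials of the CGHS coordinate and of `y` differ by a translation, which is invisible
in the modulus. -/
theorem norm_pushConv_xC_gumbelWave (g : ℝ → ℂ) (τ : ℝ) :
    ‖pushConv volume g xC gumbelWave τ‖ = ‖pushConv volume g (fun y => y) gumbelWave τ‖ := by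
  have h (y : ℝ) : g y * gumbelWave (τ - xC y) = gumbelWave τ * (g y * gumbelWave (τ - y)) := by
    rw [gumbelWave, sub_eq_add_neg, Real.exp_add, exp_neg_xC, mul_add, mul_one, ← Real.exp_add,
      Complex.ofReal_add, mul_add, neg_add, Complex.exp_add, ← sub_eq_add_neg, gumbelWave,
      gumbelWave]
    ring
  simp_rw [pushConv, h]
  rw [integral_const_mul, norm_mul, norm_gumbelWave, one_mul]

theorem Nth_eq_lintegral_Fk_xC {g : ℝ → ℂ} (hg : Integrable g) (hg0 : ∫ y, g y = 0)
    (hgp : ∀ᵐ p : ℝ, p ≤ 0 → ft g p = 0) : Nth (2 * Real.pi) g =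
      ∫⁻ p, ENNReal.ofReal (‖Fk xC g p‖ ^ 2 / (2 * p * (Real.exp (2 * Real.pi * p) - 1))) := by
  rw [lintegral_norm_Fk_sq_div hg hg0 measurable_xC]
  simp_rw [← ofReal_norm (pushConv volume g xC gumbelWave _), norm_pushConv_xC_gumbelWave,
    ofReal_norm]
  rw [← lintegral_norm_Fk_sq_div hg hg0 measurable_id', Nth,
    ← lintegral_indicator measurableSet_Ioi]
  refine lintegral_congr_ae ?_
  filter_upwards [hgp] with p hp
  by_cases h : 0 < p
  · simp only [mem_Ioi, h, indicator_of_mem, ft_eq_Fk]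
  · simp only [mem_Ioi, h, not_false_eq_true, indicator_of_notMem, ← ft_eq_Fk, hp (not_lt.1 h)]
    simp

theorem No_eq_setLIntegral_Iio (x : ℝ → ℝ) (g : ℝ → ℂ) :
    No x g = ∫⁻ p in Iio 0, ENNReal.ofReal (‖Fk x g p‖ ^ 2 / (2 * -p)) := by
  rw [No, ← lintegral_indicator measurableSet_Iio, ← lintegral_indicator measurableSet_Ioi,
    ← lintegral_neg_eq_self]
  congr 1
  ext p
  by_cases h : p < 0 <;> simp [h]

theorem planck_denominator_nonneg (p : ℝ) : 0 ≤ 2 * p * (Real.exp (2 * Real.pi * p) - 1) := by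
  rcases le_total 0 p with hp | hp
  · have : 1 ≤ Real.exp (2 * Real.pi * p) := Real.one_le_exp (by positivity)
    exact mul_nonneg (by linarith) (by linarith)
  · have : Real.exp (2 * Real.pi * p) ≤ 1 := Real.exp_le_one_iff.2
      (mul_nonpos_of_nonneg_of_nonpos (by positivity) hp)
    exact mul_nonneg_of_nonpos_of_nonpos (by linarith) (by linarith)

theorem one_div_planck_le {p : ℝ} (hp : 0 < p) :
    1 / (2 * p * (Real.exp (2 * Real.pi * p) - 1)) ≤ 1 / (4 * Real.pi * p ^ 2) := by
  have h := Real.add_one_le_exp (2 * Real.pi * p)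
  have := Real.pi_pos
  refine one_div_le_one_div_of_le (by positivity) ?_
  calc 4 * Real.pi * p ^ 2 = 2 * p * (2 * Real.pi * p) := by ring
    _ ≤ _ := by gcongr; linarith

theorem one_div_planck_of_neg {p : ℝ} (hp : p < 0) :
    1 / (2 * p * (Real.exp (2 * Real.pi * p) - 1)) =
      1 / (2 * -p) + 1 / (2 * -p * (Real.exp (2 * Real.pi * -p) - 1)) := by
  have h : Real.exp (2 * Real.pi * p) < 1 := Real.exp_lt_one_iff.2
    (mul_neg_of_pos_of_neg (by positivity) hp)
  have h1 : Real.exp (2 * Real.pi * p) - 1 ≠ 0 := by linarith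
  have h2 : 1 - Real.exp (2 * Real.pi * p) ≠ 0 := by linarith
  have h0 := (Real.exp_pos (2 * Real.pi * p)).ne'
  rw [mul_neg (2 * Real.pi), Real.exp_neg]
  generalize Real.exp (2 * Real.pi * p) = e at *
  have hp0 := hp.ne
  have h3 : e⁻¹ - 1 = (1 - e) / e := by field_simp
  rw [h3]
  field_simp
  ring

theorem No_le_Nth {g : ℝ → ℂ} (hg : Integrable g) (hg0 : ∫ y, g y = 0)
    (hgp : ∀ᵐ p : ℝ, p ≤ 0 → ft g p = 0) : No xC g ≤ Nth (2 * Real.pi) g := by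
  rw [Nth_eq_lintegral_Fk_xC hg hg0 hgp, No_eq_setLIntegral_Iio]
  refine le_trans ?_ (setLIntegral_le_lintegral (Iio 0) _)
  refine setLIntegral_mono' measurableSet_Iio fun p hp => ENNReal.ofReal_le_ofReal ?_
  rw [div_eq_mul_one_div, div_eq_mul_one_div (_ ^ 2) (2 * p * _), one_div_planck_of_neg hp]
  gcongr
  exact le_add_of_nonneg_right (one_div_nonneg.2 (planck_denominator_nonneg _))

theorem Nth_le_No_add {g : ℝ → ℂ} (hg : Integrable g) (hg0 : ∫ y, g y = 0)
    (hgp : ∀ᵐ p : ℝ, p ≤ 0 → ft g p = 0) : Nth (2 * Real.pi) g ≤ No xC g +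
      ENNReal.ofReal (4 * Real.pi)⁻¹ * ∫⁻ τ, ‖pushConv volume g xC (expKernel 0) τ‖ₑ ^ 2 := by
  have hinj : Function.Injective xC := fun a b h => by
    have h2 := congrArg (fun t => Real.exp (-t)) h
    simpa [exp_neg_xC] using h2
  have hm := (continuous_Fk hg measurable_xC).measurable
  have h2 : ENNReal.ofReal (4 * Real.pi)⁻¹ =
      ENNReal.ofReal (8 * Real.pi ^ 2)⁻¹ * ENNReal.ofReal (2 * Real.pi) := by
    rw [← ENNReal.ofReal_mul (by positivity)]
    congr 1
    field_simp
    norm_num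
  rw [h2, mul_assoc, lintegral_enorm_pushConv_heaviside_sq hg measurable_xC hinj,
    ← lintegral_const_mul' _ _ ENNReal.ofReal_ne_top, Nth_eq_lintegral_Fk_xC hg hg0 hgp,
    No_eq_setLIntegral_Iio, ← lintegral_indicator measurableSet_Iio, ← lintegral_add_left
      (Measurable.indicator (by fun_prop) measurableSet_Iio)]
  refine lintegral_mono_ae ?_
  filter_upwards [Measure.ae_ne volume 0] with p hp
  have hR : ENNReal.ofReal (8 * Real.pi ^ 2)⁻¹ *
      ‖(∫ y, g y * planeWave p (xC y)) * (Complex.I * p)⁻¹‖ₑ ^ 2 =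
      ENNReal.ofReal (‖Fk xC g p‖ ^ 2 * (1 / (4 * Real.pi * p ^ 2))) := by
    rw [← ofReal_norm_sq, ← ENNReal.ofReal_mul (by positivity), norm_Fk_sq, norm_mul, norm_inv,
      norm_mul, Complex.norm_I, one_mul, Complex.norm_real, mul_pow, inv_pow, Real.norm_eq_abs,
      sq_abs]
    congr 1
    field_simp
    ring
  rw [hR, div_eq_mul_one_div (_ ^ 2) (2 * p * _)]
  rcases lt_or_gt_of_ne hp with hp | hp
  · have h3 := one_div_planck_le (neg_pos.2 hp)
    rw [neg_sq] at h3
    rw [indicator_of_mem (mem_Iio.2 hp), div_eq_mul_one_div (_ ^ 2) (2 * -p),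
      one_div_planck_of_neg hp, mul_add]
    refine ENNReal.ofReal_add_le.trans ?_
    gcongr
  · rw [indicator_of_notMem (by simpa using hp.le), zero_add]
    refine ENNReal.ofReal_le_ofReal ?_
    exact mul_le_mul_of_nonneg_left (one_div_planck_le hp) (sq_nonneg _)

theorem lintegral_Iic_sub_rpow {s c a : ℝ} (ha : a < -1) (hc : c < s) :
    ∫⁻ t in Iic c, ENNReal.ofReal ((s - t) ^ a) =
      ENNReal.ofReal ((s - c) ^ (a + 1) / (-(a + 1))) := by
  have h1 : ∫⁻ t in Iic c, ENNReal.ofReal ((s - t) ^ a) =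
      ∫⁻ u in Ici (s - c), ENNReal.ofReal (u ^ a) := by
    rw [← lintegral_indicator measurableSet_Iic, ← lintegral_indicator measurableSet_Ici,
      ← lintegral_sub_left_eq_self _ s]
    congr 1
    ext t
    simp [indicator_apply, add_comm]
  have hsc : 0 < s - c := sub_pos.2 hc
  rw [h1, setLIntegral_congr Ioi_ae_eq_Ici.symm, ← ofReal_integral_eq_lintegral_ofReal
    (integrableOn_Ioi_rpow_of_lt ha hsc), integral_Ioi_rpow_of_lt ha hsc, div_neg, neg_div]
  filter_upwards [ae_restrict_mem measurableSet_Ioi] with u hu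
  exact Real.rpow_nonneg (hsc.trans hu).le _

theorem hasDerivAt_xC (y : ℝ) :
    HasDerivAt xC (Real.exp (-y) / (1 + Real.exp (-y))) y := by
  have h1 : HasDerivAt (fun y : ℝ => 1 + Real.exp (-y)) (-Real.exp (-y)) y := by
    simpa using ((hasDerivAt_neg y).exp).const_add 1
  have h2 := (h1.log (by positivity)).neg
  rwa [neg_div, neg_neg] at h2

theorem strictMono_xC : StrictMono xC := by
  intro a b h
  have h2 : Real.exp (-xC b) < Real.exp (-xC a) := by
    rw [exp_neg_xC, exp_neg_xC]
    gcongr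
  rw [Real.exp_lt_exp] at h2
  linarith

theorem image_xC_univ : xC '' univ = Iio 0 := by
  ext t
  rw [image_univ]
  constructor
  · rintro ⟨y, rfl⟩
    have h : 1 < Real.exp (-xC y) := by
      rw [exp_neg_xC]
      linarith [Real.exp_pos (-y)]
    rw [Real.one_lt_exp_iff] at h
    exact neg_pos.1 h
  · intro ht
    have h : 1 < Real.exp (-t) := Real.one_lt_exp_iff.2 (neg_pos.2 ht)
    refine ⟨-Real.log (Real.exp (-t) - 1), ?_⟩
    rw [xC, neg_neg, Real.exp_log (by linarith)]
    simp

theorem enorm_deriv_xC_le (y : ℝ) :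
    ENNReal.ofReal |Real.exp (-y) / (1 + Real.exp (-y))| ≤
      min 1 (ENNReal.ofReal (Real.exp (-y))) := by
  have h := Real.exp_pos (-y)
  rw [abs_of_nonneg (by positivity), le_min_iff, ENNReal.ofReal_le_one, div_le_one (by positivity)]
  refine ⟨by linarith, ENNReal.ofReal_le_ofReal (div_le_self h.le (by linarith))⟩

theorem lintegral_enorm_pushConv_xC_sq_le {g : ℝ → ℂ} (hg0 : ∫ y, g y = 0) :
    ∫⁻ τ, ‖pushConv volume g xC (expKernel 0) τ‖ₑ ^ 2 ≤
      ∫⁻ t, min 1 (ENNReal.ofReal (Real.exp (-t))) * (∫⁻ y in Iic t, ‖g y‖ₑ) ^ 2 := by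
  have h0 : ∫⁻ τ, ‖pushConv volume g xC (expKernel 0) τ‖ₑ ^ 2 =
      ∫⁻ τ in Iio 0, ‖pushConv volume g xC (expKernel 0) τ‖ₑ ^ 2 := by
    rw [← lintegral_indicator measurableSet_Iio]
    congr 1
    ext τ
    by_cases hτ : τ < 0
    · simp [hτ]
    · have h (y : ℝ) : expKernel 0 (τ - xC y) = 1 := by
        have : xC y < 0 := image_xC_univ.subset ⟨y, mem_univ y, rfl⟩
        rw [expKernel, indicator_of_mem (by rw [mem_Ici]; linarith)]
        simp
      simp [hτ, pushConv, h, hg0]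
  rw [h0, ← image_xC_univ, lintegral_image_eq_lintegral_abs_deriv_mul MeasurableSet.univ
    (fun y _ => (hasDerivAt_xC y).hasDerivWithinAt) strictMono_xC.injective.injOn,
    setLIntegral_univ]
  refine lintegral_mono fun t => ?_
  have h (y : ℝ) : g y * expKernel 0 (xC t - xC y) = (Iic t).indicator g y := by
    by_cases hy : y ≤ t
    · simp [expKernel, hy, strictMono_xC.le_iff_le]
    · simp [expKernel, hy, strictMono_xC.le_iff_le]
  gcongr
  · exact enorm_deriv_xC_le t
  · simp_rw [pushConv, h]
    rw [integral_indicator measurableSet_Iic]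
    exact enorm_integral_le_lintegral_enorm _

theorem lintegral_Iic_enorm_le {g : ℝ → ℂ} {s α C t c : ℝ} (hα : 0 < α) (hC : 0 ≤ C)
    (hcs : c < s) (hdecay : ∀ y ≤ c, ‖g y‖ ≤ C / (s - y) ^ (1 + α)) (ht : t ≤ c) :
    ∫⁻ y in Iic t, ‖g y‖ₑ ≤ ENNReal.ofReal (C / α * (s - t) ^ (-α)) := by
  calc ∫⁻ y in Iic t, ‖g y‖ₑ
      ≤ ∫⁻ y in Iic t, ENNReal.ofReal C * ENNReal.ofReal ((s - y) ^ (-(1 + α))) := by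
        refine setLIntegral_mono' measurableSet_Iic fun y hy => ?_
        have hyc : y ≤ c := le_trans hy ht
        rw [← ofReal_norm, ← ENNReal.ofReal_mul hC, Real.rpow_neg (by linarith),
          ← div_eq_mul_inv]
        exact ENNReal.ofReal_le_ofReal (hdecay y hyc)
    _ = _ := by
        rw [lintegral_const_mul' _ _ ENNReal.ofReal_ne_top,
          lintegral_Iic_sub_rpow (by linarith) (by linarith), ← ENNReal.ofReal_mul hC]
        congr 1
        rw [show -(1 + α) + 1 = -α by ring, neg_neg]
        ring

theorem lintegral_min_mul_sq_le {g : ℝ → ℂ} (hg : Integrable g) {s α C c : ℝ} (hα : 1 / 2 < α)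
    (hC : 0 ≤ C) (hcs : c < s) (hdecay : ∀ y ≤ c, ‖g y‖ ≤ C / (s - y) ^ (1 + α)) :
    ∫⁻ t, min 1 (ENNReal.ofReal (Real.exp (-t))) * (∫⁻ y in Iic t, ‖g y‖ₑ) ^ 2 ≤
      ENNReal.ofReal (C ^ 2 / (α ^ 2 * (2 * α - 1) * (s - c) ^ (2 * α - 1)) +
        Real.exp (-c) * (∫ y, ‖g y‖) ^ 2) := by
  have hsc : 0 < s - c := sub_pos.2 hcs
  have hα1 : 0 < 2 * α - 1 := by linarith
  have hα0 : 0 < α := by linarith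
  rw [← lintegral_add_compl _ (measurableSet_Iic (a := c)), compl_Iic,
    ENNReal.ofReal_add (by positivity) (by positivity)]
  refine add_le_add ?_ ?_
  · calc _ ≤ ∫⁻ t in Iic c, ENNReal.ofReal ((C / α) ^ 2) *
          ENNReal.ofReal ((s - t) ^ (-(2 * α))) := by
          refine setLIntegral_mono' measurableSet_Iic fun t ht => ?_
          have hst : 0 < s - t := by have : t ≤ c := ht; linarith
          refine (mul_le_mul' (min_le_left _ _) (pow_le_pow_left'
            (lintegral_Iic_enorm_le hα0 hC hcs hdecay ht) 2)).trans ?_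
          rw [one_mul, ← ENNReal.ofReal_pow (by positivity), ← ENNReal.ofReal_mul (by positivity),
            mul_pow, ← Real.rpow_mul_natCast hst.le]
          refine le_of_eq ?_
          congr 3
          push_cast
          ring
      _ = _ := by
          rw [lintegral_const_mul' _ _ ENNReal.ofReal_ne_top,
            lintegral_Iic_sub_rpow (by linarith) hcs, ← ENNReal.ofReal_mul (by positivity)]
          congr 1
          rw [show -(2 * α) + 1 = -(2 * α - 1) by ring, neg_neg, Real.rpow_neg hsc.le]
          field_simp
  · calc _ ≤ ∫⁻ t in Ioi c, ENNReal.ofReal (Real.exp (-t)) *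
          ENNReal.ofReal ((∫ y, ‖g y‖) ^ 2) := by
          refine setLIntegral_mono' measurableSet_Ioi fun t _ => ?_
          rw [ENNReal.ofReal_pow (by positivity), ofReal_integral_norm_eq_lintegral_enorm hg]
          exact mul_le_mul' (min_le_right _ _) (pow_le_pow_left' (setLIntegral_le_lintegral _ _) 2)
      _ = _ := by
          rw [lintegral_mul_const' _ _ ENNReal.ofReal_ne_top, ENNReal.ofReal_mul (by positivity),
            ← ofReal_integral_eq_lintegral_ofReal (integrableOn_exp_neg_Ioi c)
              (ae_of_all _ fun t => (Real.exp_pos _).le), integral_exp_neg_Ioi]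

theorem ft_tr (f : ℝ → ℂ) (s p : ℝ) : ft (tr f s) p = planeWave p s * ft f p := by
  have h (y : ℝ) : tr f s y * planeWave p y = planeWave p s * (f (y - s) * planeWave p (y - s)) := by
    have := planeWave_add p s (y - s)
    rw [add_sub_cancel] at this
    rw [tr, this]
    ring
  rw [ft_eq_Fk, ft_eq_Fk, Fk_eq, Fk_eq]
  simp_rw [h]
  rw [integral_const_mul, integral_sub_right_eq_self (fun y => f y * planeWave p y) s]
  ring

theorem integral_eq_zero_of_ft {f : ℝ → ℂ} (hf : Integrable f)
    (hfp : ∀ᵐ p : ℝ, p ≤ 0 → ft f p = 0) : ∫ y, f y = 0 := by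
  have hc : Continuous (ft f) := continuous_Fk hf measurable_id'
  have h1 : EqOn (ft f) 0 (Iio 0) := by
    refine Measure.eqOn_open_of_ae_eq (μ := volume) ?_ isOpen_Iio hc.continuousOn
      continuousOn_const
    refine (ae_restrict_iff' measurableSet_Iio).2 ?_
    filter_upwards [hfp] with p hp hp0
    exact hp (le_of_lt hp0)
  have h2 : ft f 0 = 0 := h1.closure hc continuous_const (by simp)
  have h3 : (Real.sqrt (2 * Real.pi) : ℂ)⁻¹ ≠ 0 := by
    rw [Ne, inv_eq_zero, Complex.ofReal_eq_zero]
    positivity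
  simpa only [ft, Complex.ofReal_zero, mul_zero, zero_mul, Complex.exp_zero, mul_one, mul_eq_zero,
    h3, false_or] using h2

/-- For the CGHS map, a normalized outgoing wave function `f` which is
differentiable with integrable derivative and decays like `C/|y|^{1+α}` (`α > 1/2`)
for `y ≤ -L` (`L ≥ 1`) satisfies, for all `y₀ > 0`,
`|N̄_o[f_{y₀}] - N̄^Th_{2π}[f_{y₀}]| ≤ 32C²/(α²(2α-1)(y₀/4+L-1)^{2α-1})
  + e^{2L-y₀/2}(‖f‖_{L¹}+‖f'‖_{L¹})²`. -/
theorem stmt_2 (f : ℝ → ℂ) (hf : MeasureTheory.Integrable f)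
    (hfp : ∀ᵐ p : ℝ, p ≤ 0 → ft f p = 0)
    (hnorm : (∫⁻ p in Set.Ioi (0:ℝ),
        ENNReal.ofReal (‖ft f p‖ ^ 2 / (2 * p))) = 1)
    (hdiff : Differentiable ℝ f) (hf' : MeasureTheory.Integrable (deriv f))
    (α C L : ℝ) (hα : 1/2 < α) (hC : 0 < C) (hL : 1 ≤ L)
    (hdecay : ∀ y : ℝ, y ≤ -L → ‖f y‖ ≤ C / |y| ^ (1 + α))
    (y₀ : ℝ) (hy₀ : 0 < y₀) :
    No xC (tr f y₀) - Nth (2 * Real.pi) (tr f y₀) ≤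
      ENNReal.ofReal (32 * C ^ 2 /
          (α ^ 2 * (2 * α - 1) * (y₀ / 4 + L - 1) ^ (2 * α - 1)) +
        Real.exp (2 * L - y₀ / 2) *
          ((∫ y : ℝ, ‖f y‖) + ∫ y : ℝ, ‖deriv f y‖) ^ 2) ∧
    Nth (2 * Real.pi) (tr f y₀) - No xC (tr f y₀) ≤
      ENNReal.ofReal (32 * C ^ 2 /
          (α ^ 2 * (2 * α - 1) * (y₀ / 4 + L - 1) ^ (2 * α - 1)) +
        Real.exp (2 * L - y₀ / 2) *
          ((∫ y : ℝ, ‖f y‖) + ∫ y : ℝ, ‖deriv f y‖) ^ 2) := by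
  have hg : Integrable (tr f y₀) := hf.comp_sub_right y₀
  have hgp : ∀ᵐ p : ℝ, p ≤ 0 → ft (tr f y₀) p = 0 := by
    filter_upwards [hfp] with p hp hp0
    rw [ft_tr, hp hp0, mul_zero]
  have hg0 := integral_eq_zero_of_ft hg hgp
  have hnormg : ∫ y, ‖tr f y₀ y‖ = ∫ y, ‖f y‖ := integral_sub_right_eq_self (fun y => ‖f y‖) y₀
  have hα1 : 0 < 2 * α - 1 := by linarith
  rw [tsub_eq_zero_of_le (No_le_Nth hg hg0 hgp)]
  refine ⟨zero_le, ?_⟩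
  rw [tsub_le_iff_left]
  refine (Nth_le_No_add hg hg0 hgp).trans ?_
  gcongr
  have hX := (lintegral_enorm_pushConv_xC_sq_le hg0).trans
    (lintegral_min_mul_sq_le hg hα hC.le (s := y₀) (c := y₀ / 2 - 2 * L) (by linarith)
      fun y hy => by
        have h := hdecay (y - y₀) (by linarith)
        rwa [abs_sub_comm, abs_of_pos (by linarith : 0 < y₀ - y)] at h)
  rw [hnormg] at hX
  have hpi : ENNReal.ofReal (4 * Real.pi)⁻¹ ≤ 1 := by
    rw [ENNReal.ofReal_le_one]
    exact inv_le_one_of_one_le₀ (by linarith [Real.pi_gt_three])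
  refine (mul_le_mul' hpi hX).trans ?_
  rw [one_mul]
  have hD : 0 < y₀ / 4 + L - 1 := by linarith
  have hD2 : y₀ / 4 + L - 1 ≤ y₀ - (y₀ / 2 - 2 * L) := by linarith
  have hf0 : 0 ≤ ∫ y, ‖f y‖ := by positivity
  have hf'0 : 0 ≤ ∫ y, ‖deriv f y‖ := by positivity
  refine ENNReal.ofReal_le_ofReal (add_le_add ?_ ?_)
  · gcongr
    nlinarith [sq_nonneg C]
  · rw [neg_sub]
    gcongr
    linarith
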